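/- arXiv:2404.05756 — 2 statements merged into one kernel-verified Lean document; each statement's English description precedes it below -/
import Mathlib

section
/- (Modular equation of level five for g.) For every τ ∈ ℍ, one has g(τ)⁵ − g(5τ) − 5g(τ)g(5τ)·P(g(τ), g(5τ)) = 25g(τ)²g(5τ)²·Q(g(τ), g(5τ)), where P(X,Y) = Y + 11X³ − 12X² + 7X − 2 and Q(X,Y) = 25X²Y³ − 5X(10X − 1)Y² + (35X² − 10X + 1)Y − 12X² + 7X − 2. -/
open Complex

/-- The `q`-Pochhammer infinite product `(a; q)∞ = ∏_{n=0}^∞ (1 - a qⁿ)`. -/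
noncomputable def qPoch (a q : ℂ) : ℂ := ∏' n : ℕ, (1 - a * q ^ n)

/-- The nome `q = e^{2πiτ}` of a point `τ` of the upper half-plane. -/
noncomputable def Qc (τ : UpperHalfPlane) : ℂ := Complex.exp (2 * Real.pi * Complex.I * τ)


/-- `g = (q²;q²)∞²(q⁵;q⁵)∞⁴ / ((q;q)∞⁴(q¹⁰;q¹⁰)∞²)` as a function of the nome `q`;
this is the η-quotient `η(2τ)²η(5τ)⁴/(η(τ)⁴η(10τ)²)`. -/
noncomputable def gq (q : ℂ) : ℂ :=
  qPoch (q ^ 2) (q ^ 2) ^ 2 * qPoch (q ^ 5) (q ^ 5) ^ 4 /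
    (qPoch q q ^ 4 * qPoch (q ^ 10) (q ^ 10) ^ 2)

/-- `g(τ) = gq(e^{2πiτ})`. -/
noncomputable def gfun (τ : UpperHalfPlane) : ℂ := gq (Qc τ)

/-- The point `5τ` of the upper half-plane. -/
noncomputable def mul5 (τ : UpperHalfPlane) : UpperHalfPlane := ⟨5 * (τ : ℂ), by simpa using τ.2⟩

/-- `P(X,Y) = Y + 11X³ − 12X² + 7X − 2`. -/
noncomputable def Ppoly (X Y : ℂ) : ℂ := Y + 11 * X ^ 3 - 12 * X ^ 2 + 7 * X - 2

/-- `Q(X,Y) = 25X²Y³ − 5X(10X − 1)Y² + (35X² − 10X + 1)Y − 12X² + 7X − 2`. -/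
noncomputable def Qpoly (X Y : ℂ) : ℂ :=
  25 * X ^ 2 * Y ^ 3 - 5 * X * (10 * X - 1) * Y ^ 2 + (35 * X ^ 2 - 10 * X + 1) * Y -
    12 * X ^ 2 + 7 * X - 2

namespace GF
open Filter Topology

noncomputable def E (q : ℂ) : ℂ := ∏' n : ℕ, (1 - q ^ (n + 1))
noncomputable def EN (q : ℂ) (N : ℕ) : ℂ := ∏ i ∈ Finset.range N, (1 - q ^ (i + 1))
noncomputable def th (q : ℂ) : ℂ := ∑' n : ℤ, (-1 : ℂ) ^ n * q ^ (n ^ 2)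

lemma one_sub_ne {q : ℂ} (hq : ‖q‖ < 1) (n : ℕ) : 1 - q ^ (n + 1) ≠ 0 := by
  intro h
  have h1 : q ^ (n + 1) = 1 := (sub_eq_zero.mp h).symm
  have h2 : ‖q‖ ^ (n + 1) = 1 := by rw [← norm_pow, h1, norm_one]
  have h3 : ‖q‖ ^ (n + 1) < 1 := pow_lt_one₀ (norm_nonneg _) hq (by omega)
  linarith

lemma EN_ne {q : ℂ} (hq : ‖q‖ < 1) (N : ℕ) : EN q N ≠ 0 :=
  Finset.prod_ne_zero_iff.mpr fun i _ => one_sub_ne hq i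

lemma EN_succ (q : ℂ) (N : ℕ) : EN q (N + 1) = EN q N * (1 - q ^ (N + 1)) :=
  Finset.prod_range_succ _ _

lemma EN_tendsto {q : ℂ} (hq : ‖q‖ < 1) : Tendsto (EN q) atTop (𝓝 (E q)) :=
  (ModularForm.multipliable_one_sub_pow hq).tendsto_prod_tprod_nat

lemma E_ne {q : ℂ} (hq : ‖q‖ < 1) : E q ≠ 0 := by
  have := tprod_one_add_ne_zero_of_summable (f := fun n : ℕ ↦ -q ^ (n + 1))
    (fun n => by simpa [sub_eq_add_neg] using one_sub_ne hq n)
    (by simpa using (summable_nat_add_iff 1).mpr (summable_geometric_of_lt_one (norm_nonneg _) hq))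
  simpa [E, sub_eq_add_neg] using this

lemma summable_natAbs {r : ℝ} (h0 : 0 ≤ r) (h1 : r < 1) :
    Summable fun n : ℤ => r ^ n.natAbs := by
  apply Summable.of_nat_of_neg
  · simpa using summable_geometric_of_lt_one h0 h1
  · simpa using summable_geometric_of_lt_one h0 h1

lemma summable_gen {q : ℂ} (hq0 : q ≠ 0) (hq : ‖q‖ < 1) (e : ℤ → ℤ) (he : ∀ n, |n| ≤ e n) :
    Summable fun n : ℤ => ‖(-1 : ℂ) ^ n * q ^ (e n)‖ := by
  refine Summable.of_nonneg_of_le (fun _ => norm_nonneg _) (fun n => ?_)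
    (summable_natAbs (norm_nonneg q) hq)
  rw [norm_mul, norm_zpow, norm_zpow, norm_neg, norm_one, one_zpow, one_mul,
    ← zpow_natCast]
  apply zpow_le_zpow_right_of_le_one₀ (norm_pos_iff.mpr hq0) hq.le
  simpa using he n

lemma abs_le_sq (n : ℤ) : |n| ≤ n ^ 2 := by
  rw [← sq_abs]
  rcases eq_or_ne n 0 with rfl | h
  · simp
  · have := Int.one_le_abs h
    nlinarith

lemma abs_le_2 (n : ℤ) : |n| ≤ 5 * n ^ 2 + 2 * n := by
  have := abs_le_sq n
  have := neg_abs_le n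
  nlinarith

lemma abs_le_4 (n : ℤ) : |n| ≤ 5 * n ^ 2 + 4 * n := by
  have := abs_le_sq n
  have := neg_abs_le n
  nlinarith

/-- reciprocal of the finite product, extended by zero to negative indices -/
noncomputable def Iv (Q : ℂ) (m : ℤ) : ℂ := if m < 0 then 0 else (EN Q m.toNat)⁻¹

lemma Iv_rec {Q : ℂ} (hQ : ‖Q‖ < 1) (m : ℤ) : Iv Q (m - 1) = (1 - Q ^ m) * Iv Q m := by
  unfold Iv
  rcases lt_trichotomy m 0 with h | h | h
  · rw [if_pos (by omega), if_pos h]; simp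
  · subst h; simp
  · obtain ⟨k, rfl⟩ : ∃ k : ℕ, m = k + 1 := ⟨(m - 1).toNat, by omega⟩
    rw [if_neg (by omega), if_neg (by omega)]
    have h1 : ((k : ℤ) + 1 - 1).toNat = k := by omega
    have h2 : ((k : ℤ) + 1).toNat = k + 1 := by omega
    rw [h1, h2, EN_succ]
    have h3 := EN_ne hQ k
    have h4 := one_sub_ne hQ k
    have h5 : Q ^ ((k : ℤ) + 1) = Q ^ (k + 1) := by exact_mod_cast zpow_natCast Q (k + 1)
    rw [h5]
    field_simp

lemma Iv_tendsto {Q : ℂ} (hQ : ‖Q‖ < 1) : Tendsto (Iv Q) atTop (𝓝 (E Q)⁻¹) := by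
  have h1 : Tendsto (fun m : ℤ => (EN Q m.toNat)⁻¹) atTop (𝓝 (E Q)⁻¹) := by
    refine Tendsto.inv₀ ((EN_tendsto hQ).comp ?_) (E_ne hQ)
    refine tendsto_atTop.mpr fun b => ?_
    filter_upwards [eventually_ge_atTop (b : ℤ)] with m hm
    omega
  refine h1.congr' ?_
  filter_upwards [eventually_ge_atTop (0 : ℤ)] with m hm
  simp [Iv, not_lt.mpr hm]

lemma EN_bdd {Q : ℂ} (hQ : ‖Q‖ < 1) : ∃ C, 0 ≤ C ∧ ∀ n, ‖EN Q n‖ ≤ C := by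
  obtain ⟨C, hC⟩ := (Metric.isBounded_range_of_tendsto _ (EN_tendsto hQ)).exists_norm_le
  exact ⟨C, (norm_nonneg _).trans (hC _ ⟨0, rfl⟩), fun n => hC _ ⟨n, rfl⟩⟩

lemma Iv_bdd {Q : ℂ} (hQ : ‖Q‖ < 1) : ∃ C, 0 ≤ C ∧ ∀ n, ‖Iv Q n‖ ≤ C := by
  obtain ⟨C, hC⟩ := (Metric.isBounded_range_of_tendsto _
    ((EN_tendsto hQ).inv₀ (E_ne hQ))).exists_norm_le
  have h0 : 0 ≤ C := (norm_nonneg _).trans (hC _ ⟨0, rfl⟩)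
  refine ⟨C, h0, fun n => ?_⟩
  unfold Iv
  split_ifs
  · simpa using h0
  · exact hC _ ⟨n.toNat, rfl⟩

noncomputable def bb (q : ℂ) (n : ℕ) (k : ℤ) : ℂ :=
  q ^ (k ^ 2) * EN (q ^ 2) (2 * n) * Iv (q ^ 2) (n - k) * Iv (q ^ 2) (n + k)

lemma norm_sq_lt {q : ℂ} (hq : ‖q‖ < 1) {n : ℕ} (hn : n ≠ 0) : ‖q ^ n‖ < 1 := by
  rw [norm_pow]; exact pow_lt_one₀ (norm_nonneg _) hq hn

lemma bb_rec {q : ℂ} (hq0 : q ≠ 0) (hq : ‖q‖ < 1) (n : ℕ) (k : ℤ) :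
    bb q (n + 1) k = (1 + q ^ (4 * n + 2)) * bb q n k
      + q ^ (2 * n + 1) * (bb q n (k - 1) + bb q n (k + 1)) := by
  have hQ : ‖q ^ 2‖ < 1 := norm_sq_lt hq two_ne_zero
  have r1 := Iv_rec hQ (n + 1 - k)
  have r2 := Iv_rec hQ (n + 1 + k)
  have r3 := Iv_rec hQ (n - k)
  have r4 := Iv_rec hQ (n + k)
  have e1 : (n : ℤ) + 1 - k - 1 = n - k := by ring
  have e2 : (n : ℤ) + 1 + k - 1 = n + k := by ring
  rw [e1] at r1
  rw [e2] at r2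
  unfold bb
  have f1 : (n : ℤ) - (k - 1) = n + 1 - k := by ring
  have f2 : (n : ℤ) + (k - 1) = n + k - 1 := by ring
  have f3 : (n : ℤ) - (k + 1) = n - k - 1 := by ring
  have f4 : (n : ℤ) + (k + 1) = n + 1 + k := by ring
  rw [f1, f2, f3, f4, r3, r4, r1, r2]
  have g : 2 * (n + 1) = 2 * n + 1 + 1 := by ring
  rw [g, EN_succ, EN_succ]
  push_cast
  generalize Iv (q ^ 2) (n + 1 - k) = u
  generalize Iv (q ^ 2) (n + 1 + k) = v
  generalize EN (q ^ 2) (2 * n) = w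
  have s1 : q ^ ((k - 1) ^ 2) = q ^ (k ^ 2) * q * (q ^ k)⁻¹ * (q ^ k)⁻¹ := by
    rw [← zpow_neg, ← zpow_add_one₀ hq0, ← zpow_add₀ hq0, ← zpow_add₀ hq0]
    ring_nf
  have s2 : q ^ ((k + 1) ^ 2) = q ^ (k ^ 2) * q * q ^ k * q ^ k := by
    rw [← zpow_add_one₀ hq0, ← zpow_add₀ hq0, ← zpow_add₀ hq0]
    ring_nf
  have hQ0 : q ^ 2 ≠ 0 := pow_ne_zero _ hq0
  have pk : (q ^ 2) ^ k = (q ^ k) ^ 2 := by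
    rw [← zpow_natCast, ← zpow_natCast, ← zpow_mul, ← zpow_mul, mul_comm]
  have hk : q ^ k ≠ 0 := zpow_ne_zero _ hq0
  rw [s1, s2]
  simp only [zpow_add₀ hQ0, zpow_sub₀ hQ0, zpow_natCast, zpow_one, pk]
  have p1 : q ^ (4 * n + 2) = (q ^ n) ^ 4 * q ^ 2 := by ring
  have p2 : q ^ (2 * n + 1) = (q ^ n) ^ 2 * q := by ring
  have p3 : (q ^ 2) ^ n = (q ^ n) ^ 2 := by ring
  have p4 : (q ^ 2) ^ (2 * n + 1) = (q ^ n) ^ 4 * q ^ 2 := by ring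
  have p5 : (q ^ 2) ^ (2 * n + 1 + 1) = (q ^ n) ^ 4 * q ^ 4 := by ring
  rw [p1, p2, p3, p4, p5]
  generalize q ^ (k ^ 2) = z
  generalize q ^ n = A
  revert hk
  generalize q ^ k = B
  intro hk
  field_simp
  ring

lemma bb_bound {q : ℂ} (hq : ‖q‖ < 1) : ∃ C, ∀ n k, ‖(-1 : ℂ) ^ k * bb q n k‖ ≤
    C * ‖(-1 : ℂ) ^ k * q ^ (k ^ 2)‖ := by
  have hQ : ‖q ^ 2‖ < 1 := norm_sq_lt hq two_ne_zero
  obtain ⟨C, hC0, hC⟩ := EN_bdd hQ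
  obtain ⟨D, hD0, hD⟩ := Iv_bdd hQ
  refine ⟨C * D * D, fun n k => ?_⟩
  unfold bb
  simp only [norm_mul]
  have h1 := hC (2 * n)
  have h2 := hD (n - k)
  have h3 := hD (n + k)
  calc _ = (‖EN (q ^ 2) (2 * n)‖ * ‖Iv (q ^ 2) (n - k)‖ * ‖Iv (q ^ 2) (n + k)‖) *
        (‖(-1 : ℂ) ^ k‖ * ‖q ^ (k ^ 2)‖) := by ring
    _ ≤ _ := by gcongr

lemma th_summable {q : ℂ} (hq0 : q ≠ 0) (hq : ‖q‖ < 1) :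
    Summable fun n : ℤ => ‖(-1 : ℂ) ^ n * q ^ (n ^ 2)‖ := summable_gen hq0 hq _ abs_le_sq

lemma bb_summable {q : ℂ} (hq0 : q ≠ 0) (hq : ‖q‖ < 1) (n : ℕ) :
    Summable fun k : ℤ => (-1 : ℂ) ^ k * bb q n k := by
  obtain ⟨C, hC⟩ := bb_bound hq
  exact Summable.of_norm_bounded ((th_summable hq0 hq).mul_left C) (hC n)

lemma neg_one_succ (k : ℤ) : (-1 : ℂ) ^ (k + 1) = -(-1 : ℂ) ^ k := by
  rw [zpow_add_one₀ (by norm_num)]; ring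
lemma neg_one_pred (k : ℤ) : (-1 : ℂ) ^ (k - 1) = -(-1 : ℂ) ^ k := by
  rw [zpow_sub_one₀ (by norm_num)]; norm_num

lemma bb_tsum {q : ℂ} (hq0 : q ≠ 0) (hq : ‖q‖ < 1) (n : ℕ) :
    ∑' k : ℤ, (-1 : ℂ) ^ k * bb q n k = (∏ j ∈ Finset.range n, (1 - q ^ (2 * j + 1))) ^ 2 := by
  induction n with
  | zero =>
    rw [tsum_eq_single 0]
    · simp [bb, Iv, EN]
    · intro k hk
      rcases lt_or_gt_of_ne hk with h | h
      · simp [bb, Iv, h]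
      · simp [bb, Iv, h]
  | succ n ih =>
    have hs := bb_summable hq0 hq n
    have h1 : HasSum (fun k : ℤ => (-1 : ℂ) ^ k * bb q n (k - 1))
        (-∑' k : ℤ, (-1 : ℂ) ^ k * bb q n k) := by
      have := ((Equiv.subRight (1 : ℤ)).hasSum_iff.mpr hs.hasSum).neg
      have e : (fun k : ℤ => (-1 : ℂ) ^ k * bb q n (k - 1)) = fun k : ℤ =>
          -((fun k : ℤ => (-1 : ℂ) ^ k * bb q n k) ∘ (Equiv.subRight (1 : ℤ))) k := by
        funext k
        simp [neg_one_pred]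
      rw [e]
      exact this
    have h2 : HasSum (fun k : ℤ => (-1 : ℂ) ^ k * bb q n (k + 1))
        (-∑' k : ℤ, (-1 : ℂ) ^ k * bb q n k) := by
      have := ((Equiv.addRight (1 : ℤ)).hasSum_iff.mpr hs.hasSum).neg
      have e : (fun k : ℤ => (-1 : ℂ) ^ k * bb q n (k + 1)) = fun k : ℤ =>
          -((fun k : ℤ => (-1 : ℂ) ^ k * bb q n k) ∘ (Equiv.addRight (1 : ℤ))) k := by
        funext k
        simp [neg_one_succ]
      rw [e]
      exact this
    have h3 := (hs.hasSum.mul_left (1 + q ^ (4 * n + 2))).add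
      ((h1.add h2).mul_left (q ^ (2 * n + 1)))
    rw [Finset.prod_range_succ, mul_pow, ← ih]
    have h4 : (fun k : ℤ => (-1 : ℂ) ^ k * bb q (n + 1) k) = fun k : ℤ =>
        (1 + q ^ (4 * n + 2)) * ((-1 : ℂ) ^ k * bb q n k) +
        q ^ (2 * n + 1) * ((-1 : ℂ) ^ k * bb q n (k - 1) + (-1 : ℂ) ^ k * bb q n (k + 1)) := by
      funext k
      rw [bb_rec hq0 hq]; ring
    rw [h4, h3.tsum_eq]
    ring

lemma EN_even_odd (q : ℂ) (n : ℕ) : EN q (2 * n) =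
    EN (q ^ 2) n * ∏ j ∈ Finset.range n, (1 - q ^ (2 * j + 1)) := by
  induction n with
  | zero => simp [EN]
  | succ n ih =>
    have g : 2 * (n + 1) = 2 * n + 1 + 1 := by ring
    rw [g, EN_succ, EN_succ, EN_succ, Finset.prod_range_succ, ih]
    ring

lemma tendsto_two_mul : Tendsto (fun n : ℕ => 2 * n) atTop atTop :=
  tendsto_id.const_mul_atTop' (by norm_num)

/-- Gauss: the theta function as a product -/
lemma gauss {q : ℂ} (hq0 : q ≠ 0) (hq : ‖q‖ < 1) : th q * E (q ^ 2) = E q ^ 2 := by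
  have hQ : ‖q ^ 2‖ < 1 := norm_sq_lt hq two_ne_zero
  have hE := E_ne hQ
  obtain ⟨C, hC⟩ := bb_bound hq
  have l1 : Tendsto (fun n : ℕ => ∑' k : ℤ, (-1 : ℂ) ^ k * bb q n k) atTop
      (𝓝 (∑' k : ℤ, (-1 : ℂ) ^ k * q ^ (k ^ 2) * (E (q ^ 2))⁻¹)) := by
    refine tendsto_tsum_of_dominated_convergence ((th_summable hq0 hq).mul_left C) ?_
      (Eventually.of_forall fun n k => hC n k)
    intro k
    have t1 : Tendsto (fun n : ℕ => EN (q ^ 2) (2 * n)) atTop (𝓝 (E (q ^ 2))) :=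
      (EN_tendsto hQ).comp tendsto_two_mul
    have t2 : Tendsto (fun n : ℕ => Iv (q ^ 2) (n - k)) atTop (𝓝 (E (q ^ 2))⁻¹) :=
      (Iv_tendsto hQ).comp (tendsto_atTop_add_const_right _ (-k) tendsto_natCast_atTop_atTop)
    have t3 : Tendsto (fun n : ℕ => Iv (q ^ 2) (n + k)) atTop (𝓝 (E (q ^ 2))⁻¹) :=
      (Iv_tendsto hQ).comp (tendsto_atTop_add_const_right _ k tendsto_natCast_atTop_atTop)
    have t4 := ((((tendsto_const_nhds (x := q ^ (k ^ 2))).mul t1).mul t2).mul t3).const_mul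
      ((-1 : ℂ) ^ k)
    have e : (-1 : ℂ) ^ k * (q ^ (k ^ 2) * E (q ^ 2) * (E (q ^ 2))⁻¹ * (E (q ^ 2))⁻¹) =
      (-1 : ℂ) ^ k * q ^ (k ^ 2) * (E (q ^ 2))⁻¹ := by field_simp
    rw [e] at t4
    exact t4
  rw [tsum_mul_right] at l1
  have l2 : Tendsto (fun n : ℕ => (EN q (2 * n) / EN (q ^ 2) n) ^ 2) atTop
      (𝓝 ((E q / E (q ^ 2)) ^ 2)) :=
    ((((EN_tendsto hq).comp tendsto_two_mul).div (EN_tendsto hQ) hE)).pow 2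
  have l3 : (fun n : ℕ => ∑' k : ℤ, (-1 : ℂ) ^ k * bb q n k) =
      fun n : ℕ => (EN q (2 * n) / EN (q ^ 2) n) ^ 2 := by
    funext n
    rw [bb_tsum hq0 hq, EN_even_odd, mul_div_cancel_left₀ _ (EN_ne hQ n)]
  rw [l3] at l1
  have := tendsto_nhds_unique l1 l2
  unfold th
  field_simp at this
  exact this

lemma fac {η : ℂ} (h : IsPrimitiveRoot η 5) (y : ℂ) :
    (1 - y) * (1 - η * y) * (1 - η ^ 2 * y) * (1 - η ^ 3 * y) * (1 - η ^ 4 * y) = 1 - y ^ 5 := by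
  have h0 := h.geom_sum_eq_zero (by norm_num)
  have h5 := h.pow_eq_one
  simp only [Finset.sum_range_succ, Finset.sum_range_zero, pow_zero, pow_one, zero_add] at h0
  have e1 : (1 - η * y) * (1 - η ^ 4 * y) = 1 - (η + η ^ 4) * y + y ^ 2 := by
    linear_combination y ^ 2 * h5
  have e2 : (1 - η ^ 2 * y) * (1 - η ^ 3 * y) = 1 + (1 + η + η ^ 4) * y + y ^ 2 := by
    linear_combination y ^ 2 * h5 - y * h0
  have e3 : (η + η ^ 4) ^ 2 = 1 - (η + η ^ 4) := by
    linear_combination (2 + η ^ 3) * h5 + h0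
  calc _ = (1 - y) * ((1 - η * y) * (1 - η ^ 4 * y)) * ((1 - η ^ 2 * y) * (1 - η ^ 3 * y)) := by
        ring
    _ = _ := by
        rw [e1, e2]
        linear_combination (-(1 - y) * y ^ 2) * e3

lemma fac_add {η : ℂ} (h : IsPrimitiveRoot η 5) (a u v : ℂ) :
    (a + u + v) * (a + η * u + η ^ 4 * v) * (a + η ^ 2 * u + (η ^ 2) ^ 4 * v) *
      (a + η ^ 3 * u + (η ^ 3) ^ 4 * v) * (a + η ^ 4 * u + (η ^ 4) ^ 4 * v) =
    a ^ 5 + u ^ 5 + v ^ 5 - 5 * a ^ 3 * u * v + 5 * a * u ^ 2 * v ^ 2 := by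
  have h0 := h.geom_sum_eq_zero (by norm_num)
  have h5 := h.pow_eq_one
  simp only [Finset.sum_range_succ, Finset.sum_range_zero, pow_zero, pow_one, zero_add] at h0
  have q2 : (η ^ 2) ^ 4 = η ^ 3 := by linear_combination η ^ 3 * h5
  have q3 : (η ^ 3) ^ 4 = η ^ 2 := by linear_combination (η ^ 7 + η ^ 2) * h5
  have q4 : (η ^ 4) ^ 4 = η := by linear_combination (η ^ 11 + η ^ 6 + η) * h5
  rw [q2, q3, q4]
  have e1 : (a + η * u + η ^ 4 * v) * (a + η ^ 4 * u + η * v) =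
      a ^ 2 + u ^ 2 + v ^ 2 + (η + η ^ 4) * a * (u + v) + (-1 - (η + η ^ 4)) * u * v := by
    linear_combination (u ^ 2 + v ^ 2 + η ^ 3 * u * v) * h5 + u * v * h0
  have e2 : (a + η ^ 2 * u + η ^ 3 * v) * (a + η ^ 3 * u + η ^ 2 * v) =
      a ^ 2 + u ^ 2 + v ^ 2 + (-1 - (η + η ^ 4)) * a * (u + v) + (η + η ^ 4) * u * v := by
    linear_combination (u ^ 2 + v ^ 2 + η * u * v) * h5 + a * (u + v) * h0
  have e3 : (η + η ^ 4) ^ 2 = 1 - (η + η ^ 4) := by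
    linear_combination (2 + η ^ 3) * h5 + h0
  calc _ = (a + u + v) * ((a + η * u + η ^ 4 * v) * (a + η ^ 4 * u + η * v)) *
        ((a + η ^ 2 * u + η ^ 3 * v) * (a + η ^ 3 * u + η ^ 2 * v)) := by ring
    _ = _ := by
        rw [e1, e2]
        generalize η + η ^ 4 = c at e3
        linear_combination (-(a + u + v) * (a * (u + v) - u * v) ^ 2) * e3

lemma fac_res {ζ : ℂ} (h : IsPrimitiveRoot ζ 5) (x : ℂ) (N r : ℕ) (hr : r.Coprime 5) :
    (1 - x ^ (5 * N + r)) * (1 - (ζ * x) ^ (5 * N + r)) * (1 - (ζ ^ 2 * x) ^ (5 * N + r)) *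
      (1 - (ζ ^ 3 * x) ^ (5 * N + r)) * (1 - (ζ ^ 4 * x) ^ (5 * N + r)) =
    1 - (x ^ 5) ^ (5 * N + r) := by
  have h5 := h.pow_eq_one
  have hη := h.pow_of_coprime r hr
  have key := fac hη (x ^ (5 * N + r))
  have z : ζ ^ (5 * N + r) = ζ ^ r := by rw [pow_add, pow_mul, h5, one_pow, one_mul]
  have m : ∀ j : ℕ, (ζ ^ j * x) ^ (5 * N + r) = (ζ ^ r) ^ j * x ^ (5 * N + r) := by
    intro j
    rw [mul_pow, ← pow_mul, mul_comm j, pow_mul, z]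
  have m1 := m 1
  rw [pow_one, pow_one] at m1
  rw [m1, m 2, m 3, m 4, key, ← pow_mul, ← pow_mul, mul_comm]

lemma EN_roots {ζ : ℂ} (h : IsPrimitiveRoot ζ 5) (x : ℂ) (N : ℕ) :
    EN (x ^ 25) N * (EN x (5 * N) * EN (ζ * x) (5 * N) * EN (ζ ^ 2 * x) (5 * N) *
      EN (ζ ^ 3 * x) (5 * N) * EN (ζ ^ 4 * x) (5 * N)) =
    EN (x ^ 5) (5 * N) * EN (x ^ 5) N ^ 5 := by
  induction N with
  | zero => simp [EN]
  | succ N ih =>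
    have g : 5 * (N + 1) = 5 * N + 1 + 1 + 1 + 1 + 1 := by ring
    have a1 := fac_res h x N 1 (by norm_num)
    have a2 := fac_res h x N 2 (by norm_num)
    have a3 := fac_res h x N 3 (by norm_num)
    have a4 := fac_res h x N 4 (by norm_num)
    have h5 := h.pow_eq_one
    have p : ∀ j : ℕ, (ζ ^ j * x) ^ (5 * N + 5) = (x ^ 5) ^ (N + 1) := by
      intro j
      have e : 5 * N + 5 = 5 * (N + 1) := by ring
      rw [e, pow_mul, mul_pow, ← pow_mul, mul_comm j, pow_mul, h5, one_pow, one_mul]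
    have p0 := p 0
    have p1 := p 1
    rw [pow_zero, one_mul] at p0
    rw [pow_one] at p1
    have p25 : (x ^ 25) ^ (N + 1) = (x ^ 5) ^ (5 * N + 5) := by ring
    rw [g]
    simp only [EN_succ]
    simp only [add_assoc, Nat.reduceAdd]
    rw [p0, p1, p 2, p 3, p 4, p25, ← a1, ← a2, ← a3, ← a4]
    generalize 1 - x ^ (5 * N + 1) = y10
    generalize 1 - (ζ * x) ^ (5 * N + 1) = y11
    generalize 1 - (ζ ^ 2 * x) ^ (5 * N + 1) = y12
    generalize 1 - (ζ ^ 3 * x) ^ (5 * N + 1) = y13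
    generalize 1 - (ζ ^ 4 * x) ^ (5 * N + 1) = y14
    generalize 1 - x ^ (5 * N + 2) = y20
    generalize 1 - (ζ * x) ^ (5 * N + 2) = y21
    generalize 1 - (ζ ^ 2 * x) ^ (5 * N + 2) = y22
    generalize 1 - (ζ ^ 3 * x) ^ (5 * N + 2) = y23
    generalize 1 - (ζ ^ 4 * x) ^ (5 * N + 2) = y24
    generalize 1 - x ^ (5 * N + 3) = y30
    generalize 1 - (ζ * x) ^ (5 * N + 3) = y31
    generalize 1 - (ζ ^ 2 * x) ^ (5 * N + 3) = y32
    generalize 1 - (ζ ^ 3 * x) ^ (5 * N + 3) = y33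
    generalize 1 - (ζ ^ 4 * x) ^ (5 * N + 3) = y34
    generalize 1 - x ^ (5 * N + 4) = y40
    generalize 1 - (ζ * x) ^ (5 * N + 4) = y41
    generalize 1 - (ζ ^ 2 * x) ^ (5 * N + 4) = y42
    generalize 1 - (ζ ^ 3 * x) ^ (5 * N + 4) = y43
    generalize 1 - (ζ ^ 4 * x) ^ (5 * N + 4) = y44
    generalize 1 - (x ^ 5) ^ (5 * N + 5) = c
    generalize 1 - (x ^ 5) ^ (N + 1) = d
    linear_combination (c * d ^ 5 * y10 * y11 * y12 * y13 * y14 *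
      y20 * y21 * y22 * y23 * y24 *
      y30 * y31 * y32 * y33 * y34 *
      y40 * y41 * y42 * y43 * y44) * ih

lemma norm_rot {ζ : ℂ} (h : IsPrimitiveRoot ζ 5) {x : ℂ} (hx : ‖x‖ < 1) (j : ℕ) :
    ‖ζ ^ j * x‖ < 1 := by
  rw [norm_mul, norm_pow, h.norm'_eq_one (by norm_num), one_pow, one_mul]
  exact hx

lemma E_roots {ζ : ℂ} (h : IsPrimitiveRoot ζ 5) {x : ℂ} (hx : ‖x‖ < 1) :
    E (x ^ 25) * (E x * E (ζ * x) * E (ζ ^ 2 * x) * E (ζ ^ 3 * x) * E (ζ ^ 4 * x)) =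
      E (x ^ 5) ^ 6 := by
  have t5 : Tendsto (fun n : ℕ => 5 * n) atTop atTop :=
    tendsto_id.const_mul_atTop' (by norm_num)
  have m : ∀ {y : ℂ}, ‖y‖ < 1 → Tendsto (fun n : ℕ => EN y (5 * n)) atTop (𝓝 (E y)) :=
    fun hy => (EN_tendsto hy).comp t5
  have h1 : ‖ζ * x‖ < 1 := by simpa using norm_rot h hx 1
  have L := (EN_tendsto (norm_sq_lt hx (n := 25) (by norm_num))).mul
    (((((m hx).mul (m h1)).mul (m (norm_rot h hx 2))).mul
      (m (norm_rot h hx 3))).mul (m (norm_rot h hx 4)))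
  have hx5 := norm_sq_lt hx (n := 5) (by norm_num)
  have R := (m hx5).mul ((EN_tendsto hx5).pow 5)
  have := tendsto_nhds_unique (L.congr (EN_roots h x)) R
  rw [this]
  ring

lemma th_ne {q : ℂ} (hq0 : q ≠ 0) (hq : ‖q‖ < 1) : th q ≠ 0 := by
  intro h
  have := gauss hq0 hq
  rw [h, zero_mul] at this
  exact pow_ne_zero 2 (E_ne hq) this.symm

lemma th_eq {q : ℂ} (hq0 : q ≠ 0) (hq : ‖q‖ < 1) : th q = E q ^ 2 / E (q ^ 2) := by
  rw [eq_div_iff (E_ne (norm_sq_lt hq two_ne_zero)), gauss hq0 hq]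

lemma th_roots {ζ : ℂ} (h : IsPrimitiveRoot ζ 5) {x : ℂ} (hx0 : x ≠ 0) (hx : ‖x‖ < 1) :
    th (x ^ 25) * (th x * th (ζ * x) * th (ζ ^ 2 * x) * th (ζ ^ 3 * x) * th (ζ ^ 4 * x)) =
      th (x ^ 5) ^ 6 := by
  have hζ : ζ ≠ 0 := h.ne_zero (by norm_num)
  have h1 : ‖ζ * x‖ < 1 := by simpa using norm_rot h hx 1
  have hx2 := norm_sq_lt hx (n := 2) (by norm_num)
  have A := E_roots h hx
  have B := E_roots (h.pow_of_coprime 2 (by norm_num)) hx2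
  have n := fun j : ℕ => mul_ne_zero (pow_ne_zero j hζ) hx0
  rw [th_eq (pow_ne_zero _ hx0) (norm_sq_lt hx (by norm_num)),
    th_eq (pow_ne_zero _ hx0) (norm_sq_lt hx (by norm_num)), th_eq hx0 hx,
    th_eq (mul_ne_zero hζ hx0) h1, th_eq (n 2) (norm_rot h hx 2),
    th_eq (n 3) (norm_rot h hx 3), th_eq (n 4) (norm_rot h hx 4)]
  have c0 : (x ^ 25) ^ 2 = (x ^ 2) ^ 25 := by ring
  have c1 : (x ^ 5) ^ 2 = (x ^ 2) ^ 5 := by ring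
  have c2 : (ζ * x) ^ 2 = ζ ^ 2 * x ^ 2 := by ring
  have c3 : (ζ ^ 2 * x) ^ 2 = (ζ ^ 2) ^ 2 * x ^ 2 := by ring
  have c4 : (ζ ^ 3 * x) ^ 2 = (ζ ^ 2) ^ 3 * x ^ 2 := by ring
  have c5 : (ζ ^ 4 * x) ^ 2 = (ζ ^ 2) ^ 4 * x ^ 2 := by ring
  rw [c0, c1, c2, c3, c4, c5, div_pow, ← pow_mul (E (x ^ 5)), mul_comm 2 6, pow_mul, ← A, ← B]
  ring

section dissect

lemma tsum_split {α β : Type*} (e : β ≃ α × Fin 5) {f : β → ℂ} (hf : Summable f) :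
    ∑' b, f b = ∑ r : Fin 5, ∑' a, f (e.symm (a, r)) := by
  let e' : Fin 5 × α ≃ β := (Equiv.prodComm _ _).trans e.symm
  rw [← e'.tsum_eq f, Summable.tsum_prod (f := fun c => f (e' c)) (e'.summable_iff.mpr hf), tsum_fintype]
  rfl

noncomputable def FF (w : ℂ) : ℂ := ∑' n : ℤ, (-1 : ℂ) ^ n * w ^ (5 * n ^ 2 + 2 * n)
noncomputable def GG (w : ℂ) : ℂ := ∑' n : ℤ, (-1 : ℂ) ^ n * w ^ (5 * n ^ 2 + 4 * n)

lemma neg_one_neg (n : ℤ) : (-1 : ℂ) ^ (-n) = (-1) ^ n := by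
  rw [zpow_neg, ← inv_zpow]; norm_num

lemma FF_neg (w : ℂ) : ∑' n : ℤ, (-1 : ℂ) ^ n * w ^ (5 * n ^ 2 - 2 * n) = FF w := by
  rw [← (Equiv.neg ℤ).tsum_eq, FF]
  congr 1; funext n
  simp only [Equiv.neg_apply, neg_one_neg]
  ring_nf

lemma GG_neg (w : ℂ) : ∑' n : ℤ, (-1 : ℂ) ^ n * w ^ (5 * n ^ 2 - 4 * n) = GG w := by
  rw [← (Equiv.neg ℤ).tsum_eq, GG]
  congr 1; funext n
  simp only [Equiv.neg_apply, neg_one_neg]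
  ring_nf

lemma neg_one_five (a : ℤ) : (-1 : ℂ) ^ (a * 5) = (-1) ^ a := by
  rw [mul_comm, zpow_mul]; norm_num

lemma th_dissect {y : ℂ} (hy0 : y ≠ 0) (hy : ‖y‖ < 1) :
    th y = th (y ^ 25) + (-2 * y) * FF (y ^ 5) + 2 * y ^ 4 * GG (y ^ 5) := by
  have hm : (-1 : ℂ) ≠ 0 := by norm_num
  have z5 : ∀ k : ℤ, (y ^ 5) ^ k = y ^ (5 * k) := fun k => by
    rw [zpow_mul]; norm_cast
  have z25 : ∀ k : ℤ, (y ^ 25) ^ k = y ^ (25 * k) := fun k => by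
    rw [zpow_mul]; norm_cast
  conv_lhs => unfold th
  rw [tsum_split (Int.divModEquiv 5) (th_summable hy0 hy).of_norm]
  simp only [Fin.sum_univ_five, Int.divModEquiv_symm_apply]
  have s0 : ∑' a : ℤ, (-1 : ℂ) ^ (a * (5 : ℕ) + ((0 : Fin 5) : ℕ) : ℤ) *
      y ^ ((a * (5 : ℕ) + ((0 : Fin 5) : ℕ) : ℤ) ^ 2) = th (y ^ 25) := by
    unfold th
    congr 1; funext a
    rw [z25]
    simp only [Fin.val_zero, Nat.cast_zero, add_zero, Nat.cast_ofNat, neg_one_five]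
    ring_nf
  have s1 : ∑' a : ℤ, (-1 : ℂ) ^ (a * (5 : ℕ) + ((1 : Fin 5) : ℕ) : ℤ) *
      y ^ ((a * (5 : ℕ) + ((1 : Fin 5) : ℕ) : ℤ) ^ 2) = -y * FF (y ^ 5) := by
    unfold FF
    rw [← tsum_mul_left]
    congr 1; funext a
    have e : y ^ ((a * 5 + 1) ^ 2) = y * y ^ (5 * (5 * a ^ 2 + 2 * a)) := by
      rw [← zpow_one_add₀ hy0]; ring_nf
    rw [z5]
    simp only [Fin.val_one, Nat.cast_one, Nat.cast_ofNat]
    rw [e, zpow_add₀ hm, neg_one_five]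
    norm_num
    ring
  have s2 : ∑' a : ℤ, (-1 : ℂ) ^ (a * (5 : ℕ) + ((2 : Fin 5) : ℕ) : ℤ) *
      y ^ ((a * (5 : ℕ) + ((2 : Fin 5) : ℕ) : ℤ) ^ 2) = y ^ 4 * GG (y ^ 5) := by
    unfold GG
    rw [← tsum_mul_left]
    congr 1; funext a
    have e : y ^ ((a * 5 + 2) ^ 2) = y ^ 4 * y ^ (5 * (5 * a ^ 2 + 4 * a)) := by
      rw [← zpow_natCast y 4, ← zpow_add₀ hy0]; push_cast; ring_nf
    rw [z5]
    simp only [Fin.val_two, Nat.cast_ofNat]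
    rw [e, zpow_add₀ hm, neg_one_five]
    norm_num
    ring
  have s3 : ∑' a : ℤ, (-1 : ℂ) ^ (a * (5 : ℕ) + ((3 : Fin 5) : ℕ) : ℤ) *
      y ^ ((a * (5 : ℕ) + ((3 : Fin 5) : ℕ) : ℤ) ^ 2) = y ^ 4 * GG (y ^ 5) := by
    rw [← GG_neg, ← (Equiv.subRight (1 : ℤ)).tsum_eq, ← tsum_mul_left]
    congr 1; funext a
    have e : y ^ (((a - 1) * 5 + 3) ^ 2) = y ^ 4 * y ^ (5 * (5 * a ^ 2 - 4 * a)) := by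
      rw [← zpow_natCast y 4, ← zpow_add₀ hy0]; push_cast; ring_nf
    have e3 : (-1 : ℂ) ^ ((a - 1) * 5 + 3) = (-1) ^ a := by
      rw [zpow_add₀ hm, neg_one_five, neg_one_pred]; norm_num
    rw [z5]
    change (-1 : ℂ) ^ ((a - 1) * 5 + 3) * y ^ (((a - 1) * 5 + 3) ^ 2) = _
    rw [e, e3]
    ring
  have s4 : ∑' a : ℤ, (-1 : ℂ) ^ (a * (5 : ℕ) + ((4 : Fin 5) : ℕ) : ℤ) *
      y ^ ((a * (5 : ℕ) + ((4 : Fin 5) : ℕ) : ℤ) ^ 2) = -y * FF (y ^ 5) := by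
    rw [← FF_neg, ← (Equiv.subRight (1 : ℤ)).tsum_eq, ← tsum_mul_left]
    congr 1; funext a
    have e : y ^ (((a - 1) * 5 + 4) ^ 2) = y * y ^ (5 * (5 * a ^ 2 - 2 * a)) := by
      rw [← zpow_one_add₀ hy0]; ring_nf
    have e3 : (-1 : ℂ) ^ ((a - 1) * 5 + 4) = -(-1) ^ a := by
      rw [zpow_add₀ hm, neg_one_five, neg_one_pred]; norm_num
    rw [z5]
    change (-1 : ℂ) ^ ((a - 1) * 5 + 4) * y ^ (((a - 1) * 5 + 4) ^ 2) = _
    rw [e, e3]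
    ring
  rw [s0, s1, s2, s3, s4]
  ring

/-- the pair `(m, n)` corresponds to `m = 2 a + b + r`, `n = a - 2 b` -/
def eqv2 : ℤ × ℤ ≃ (ℤ × ℤ) × Fin 5 where
  toFun p := ((p.2 + 2 * (Int.divModEquiv 5 (p.1 - 2 * p.2)).1,
    (Int.divModEquiv 5 (p.1 - 2 * p.2)).1), (Int.divModEquiv 5 (p.1 - 2 * p.2)).2)
  invFun s := (2 * s.1.1 + s.1.2 + (s.2 : ℕ), s.1.1 - 2 * s.1.2)
  left_inv p := by
    have := (Int.divModEquiv 5).symm_apply_apply (p.1 - 2 * p.2)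
    rw [Int.divModEquiv_symm_apply] at this
    push_cast at this
    ext
    · dsimp only
      linarith
    · dsimp only
      ring
  right_inv s := by
    obtain ⟨⟨a, b⟩, r⟩ := s
    have := (Int.divModEquiv 5).apply_symm_apply (b, r)
    rw [Int.divModEquiv_symm_apply] at this
    push_cast at this
    have e : 2 * a + b + (r : ℕ) - 2 * (a - 2 * b) = b * 5 + (r : ℕ) := by ring
    dsimp only
    rw [e, this]
    ext <;> simp

lemma prod_tsum {w : ℂ} (hw0 : w ≠ 0) (hw : ‖w‖ < 1) (c : ℂ) (e f : ℤ → ℤ)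
    (he : ∀ n, |n| ≤ e n) (hf : ∀ n, |n| ≤ f n) :
    ∑' p : ℤ × ℤ, c * (((-1 : ℂ) ^ p.1 * w ^ e p.1) * ((-1 : ℂ) ^ p.2 * w ^ f p.2)) =
      c * ((∑' n : ℤ, (-1 : ℂ) ^ n * w ^ e n) * ∑' n : ℤ, (-1 : ℂ) ^ n * w ^ f n) := by
  rw [tsum_mul_left, tsum_mul_tsum_of_summable_norm (summable_gen hw0 hw e he)
    (summable_gen hw0 hw f hf)]

lemma abs_le_5 (n : ℤ) : |n| ≤ 5 * n ^ 2 := by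
  have := abs_le_sq n
  have := abs_nonneg n
  nlinarith

lemma abs_le_2' (n : ℤ) : |n| ≤ 5 * n ^ 2 - 2 * n := by
  have := abs_le_2 (-n)
  rw [abs_neg] at this; linarith

lemma abs_le_4' (n : ℤ) : |n| ≤ 5 * n ^ 2 - 4 * n := by
  have := abs_le_4 (-n)
  rw [abs_neg] at this; linarith

lemma term_eq {w : ℂ} (hw0 : w ≠ 0) (m n a b e f d s : ℤ) (h1 : m ^ 2 + n ^ 2 = d + e + f)
    (h2 : m + n = s + a + b + 2 * (a - b)) :
    ((-1 : ℂ) ^ m * w ^ m ^ 2) * ((-1 : ℂ) ^ n * w ^ n ^ 2) =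
      ((-1) ^ s * w ^ d) * (((-1 : ℂ) ^ a * w ^ e) * ((-1 : ℂ) ^ b * w ^ f)) := by
  have hm : (-1 : ℂ) ≠ 0 := by norm_num
  have A : (-1 : ℂ) ^ m * (-1) ^ n = (-1) ^ s * (-1) ^ a * (-1) ^ b := by
    rw [← zpow_add₀ hm, h2, zpow_add₀ hm, zpow_add₀ hm, zpow_add₀ hm, zpow_mul]; norm_num
  have B : w ^ m ^ 2 * w ^ n ^ 2 = w ^ d * w ^ e * w ^ f := by
    rw [← zpow_add₀ hw0, h1, zpow_add₀ hw0, zpow_add₀ hw0]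
  linear_combination (w ^ m ^ 2 * w ^ n ^ 2) * A + ((-1) ^ s * (-1) ^ a * (-1) ^ b) * B

lemma th_sq {w : ℂ} (hw0 : w ≠ 0) (hw : ‖w‖ < 1) :
    th w ^ 2 = th (w ^ 5) ^ 2 - 4 * w * FF w * GG w := by
  have hs := th_summable hw0 hw
  have h5 : th (w ^ 5) = ∑' n : ℤ, (-1 : ℂ) ^ n * w ^ (5 * n ^ 2) := by
    unfold th
    congr 1; funext n
    rw [zpow_mul w 5]; norm_cast
  conv_lhs => rw [sq]; unfold th
  rw [tsum_mul_tsum_of_summable_norm hs hs, tsum_split eqv2 (summable_mul_of_summable_norm hs hs)]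
  simp only [Fin.sum_univ_five, eqv2, Equiv.coe_fn_symm_mk]
  have k0 := prod_tsum hw0 hw ((-1 : ℂ) ^ (0 : ℤ) * w ^ (0 : ℤ)) (fun n => 5 * n ^ 2)
    (fun n => 5 * n ^ 2) abs_le_5 abs_le_5
  have k1 := prod_tsum hw0 hw ((-1 : ℂ) ^ (1 : ℤ) * w ^ (1 : ℤ)) (fun n => 5 * n ^ 2 + 4 * n)
    (fun n => 5 * n ^ 2 + 2 * n) abs_le_4 abs_le_2
  have k2 := prod_tsum hw0 hw ((-1 : ℂ) ^ (-1 : ℤ) * w ^ (1 : ℤ)) (fun n => 5 * n ^ 2 - 2 * n)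
    (fun n => 5 * n ^ 2 + 4 * n) abs_le_2' abs_le_4
  have k3 := prod_tsum hw0 hw ((-1 : ℂ) ^ (1 : ℤ) * w ^ (1 : ℤ)) (fun n => 5 * n ^ 2 + 2 * n)
    (fun n => 5 * n ^ 2 - 4 * n) abs_le_2 abs_le_4'
  have k4 := prod_tsum hw0 hw ((-1 : ℂ) ^ (-1 : ℤ) * w ^ (1 : ℤ)) (fun n => 5 * n ^ 2 - 4 * n)
    (fun n => 5 * n ^ 2 - 2 * n) abs_le_4' abs_le_2'
  simp only [FF_neg, GG_neg, ← h5] at k0 k1 k2 k3 k4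
  rw [← FF, ← GG] at k1
  rw [← GG] at k2
  rw [← FF] at k3
  have j0 := Equiv.tsum_eq ((Equiv.subRight (0 : ℤ)).prodCongr (Equiv.subRight (0 : ℤ)))
    (fun a : ℤ × ℤ => ((-1 : ℂ) ^ (2 * a.1 + a.2 + ((0 : Fin 5) : ℕ) : ℤ) *
      w ^ (2 * a.1 + a.2 + ((0 : Fin 5) : ℕ) : ℤ) ^ 2) *
      ((-1 : ℂ) ^ (a.1 - 2 * a.2) * w ^ (a.1 - 2 * a.2) ^ 2))
  have j1 := Equiv.tsum_eq ((Equiv.subRight (0 : ℤ)).prodCongr (Equiv.subRight (0 : ℤ)))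
    (fun a : ℤ × ℤ => ((-1 : ℂ) ^ (2 * a.1 + a.2 + ((1 : Fin 5) : ℕ) : ℤ) *
      w ^ (2 * a.1 + a.2 + ((1 : Fin 5) : ℕ) : ℤ) ^ 2) *
      ((-1 : ℂ) ^ (a.1 - 2 * a.2) * w ^ (a.1 - 2 * a.2) ^ 2))
  have j2 := Equiv.tsum_eq ((Equiv.subRight (1 : ℤ)).prodCongr (Equiv.subRight (0 : ℤ)))
    (fun a : ℤ × ℤ => ((-1 : ℂ) ^ (2 * a.1 + a.2 + ((2 : Fin 5) : ℕ) : ℤ) *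
      w ^ (2 * a.1 + a.2 + ((2 : Fin 5) : ℕ) : ℤ) ^ 2) *
      ((-1 : ℂ) ^ (a.1 - 2 * a.2) * w ^ (a.1 - 2 * a.2) ^ 2))
  have j3 := Equiv.tsum_eq ((Equiv.subRight (1 : ℤ)).prodCongr (Equiv.subRight (1 : ℤ)))
    (fun a : ℤ × ℤ => ((-1 : ℂ) ^ (2 * a.1 + a.2 + ((3 : Fin 5) : ℕ) : ℤ) *
      w ^ (2 * a.1 + a.2 + ((3 : Fin 5) : ℕ) : ℤ) ^ 2) *
      ((-1 : ℂ) ^ (a.1 - 2 * a.2) * w ^ (a.1 - 2 * a.2) ^ 2))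
  have j4 := Equiv.tsum_eq ((Equiv.subRight (2 : ℤ)).prodCongr (Equiv.subRight (1 : ℤ)))
    (fun a : ℤ × ℤ => ((-1 : ℂ) ^ (2 * a.1 + a.2 + ((4 : Fin 5) : ℕ) : ℤ) *
      w ^ (2 * a.1 + a.2 + ((4 : Fin 5) : ℕ) : ℤ) ^ 2) *
      ((-1 : ℂ) ^ (a.1 - 2 * a.2) * w ^ (a.1 - 2 * a.2) ^ 2))
  rw [← j0, ← j1, ← j2, ← j3, ← j4]
  have i0 : ∀ p : ℤ × ℤ, _ = _ := fun p => term_eq hw0 (2 * (p.1 - 0) + (p.2 - 0) + 0)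
    ((p.1 - 0) - 2 * (p.2 - 0)) p.1 p.2 (5 * p.1 ^ 2) (5 * p.2 ^ 2) 0 0 (by ring) (by ring)
  have i1 : ∀ p : ℤ × ℤ, _ = _ := fun p => term_eq hw0 (2 * (p.1 - 0) + (p.2 - 0) + 1)
    ((p.1 - 0) - 2 * (p.2 - 0)) p.1 p.2 (5 * p.1 ^ 2 + 4 * p.1) (5 * p.2 ^ 2 + 2 * p.2) 1 1
    (by ring) (by ring)
  have i2 : ∀ p : ℤ × ℤ, _ = _ := fun p => term_eq hw0 (2 * (p.1 - 1) + (p.2 - 0) + 2)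
    ((p.1 - 1) - 2 * (p.2 - 0)) p.1 p.2 (5 * p.1 ^ 2 - 2 * p.1) (5 * p.2 ^ 2 + 4 * p.2) 1 (-1)
    (by ring) (by ring)
  have i3 : ∀ p : ℤ × ℤ, _ = _ := fun p => term_eq hw0 (2 * (p.1 - 1) + (p.2 - 1) + 3)
    ((p.1 - 1) - 2 * (p.2 - 1)) p.1 p.2 (5 * p.1 ^ 2 + 2 * p.1) (5 * p.2 ^ 2 - 4 * p.2) 1 1
    (by ring) (by ring)
  have i4 : ∀ p : ℤ × ℤ, _ = _ := fun p => term_eq hw0 (2 * (p.1 - 2) + (p.2 - 1) + 4)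
    ((p.1 - 2) - 2 * (p.2 - 1)) p.1 p.2 (5 * p.1 ^ 2 - 4 * p.1) (5 * p.2 ^ 2 - 2 * p.2) 1 (-1)
    (by ring) (by ring)
  have l0 := (tsum_congr i0).trans k0
  have l1 := (tsum_congr i1).trans k1
  have l2 := (tsum_congr i2).trans k2
  have l3 := (tsum_congr i3).trans k3
  have l4 := (tsum_congr i4).trans k4
  refine (congrArg₂ (· + ·) (congrArg₂ (· + ·) (congrArg₂ (· + ·) (congrArg₂ (· + ·) l0 l1) l2)
    l3) l4).trans ?_
  norm_num
  ring

end dissect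

lemma final_alg {t W : ℂ} (ht : t ≠ 0) (hW : W ≠ 0) (X Y : ℂ) (hX : X = W / t ^ 2) (hY : Y = 1 / W)
    (h : (t - 1) ^ 5 - 5 * (W - 1) * (t - 1) ^ 3 + 5 * (W - 1) ^ 2 * (t - 1) =
      W ^ 3 - 1 + 5 * (W - 1) - 5 * (W - 1) ^ 2) :
    X ^ 5 - Y - 5 * X * Y * (Y + 11 * X ^ 3 - 12 * X ^ 2 + 7 * X - 2) =
      25 * X ^ 2 * Y ^ 2 * (25 * X ^ 2 * Y ^ 3 - 5 * X * (10 * X - 1) * Y ^ 2 +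
        (35 * X ^ 2 - 10 * X + 1) * Y - 12 * X ^ 2 + 7 * X - 2) := by
  have key : X ^ 5 - Y - 5 * X * Y * (Y + 11 * X ^ 3 - 12 * X ^ 2 + 7 * X - 2) -
      25 * X ^ 2 * Y ^ 2 * (25 * X ^ 2 * Y ^ 3 - 5 * X * (10 * X - 1) * Y ^ 2 +
        (35 * X ^ 2 - 10 * X + 1) * Y - 12 * X ^ 2 + 7 * X - 2) =
      ((t - 1) ^ 5 - 5 * (W - 1) * (t - 1) ^ 3 + 5 * (W - 1) ^ 2 * (t - 1) -
      (W ^ 3 - 1 + 5 * (W - 1) - 5 * (W - 1) ^ 2)) *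
      ((-t - 1) ^ 5 - 5 * (W - 1) * (-t - 1) ^ 3 + 5 * (W - 1) ^ 2 * (-t - 1) -
      (W ^ 3 - 1 + 5 * (W - 1) - 5 * (W - 1) ^ 2)) / (W * t ^ 10) := by
    rw [hX, hY]
    field_simp
    ring
  rw [h, sub_self, zero_mul, zero_div] at key
  exact sub_eq_zero.mp key

lemma theta_rel {x : ℂ} (hx0 : x ≠ 0) (hx : ‖x‖ < 1) (t W : ℂ) (ht : t = th x / th (x ^ 25))
    (hW : W = th (x ^ 5) ^ 2 / th (x ^ 25) ^ 2) :
    (t - 1) ^ 5 - 5 * (W - 1) * (t - 1) ^ 3 + 5 * (W - 1) ^ 2 * (t - 1) =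
      W ^ 3 - 1 + 5 * (W - 1) - 5 * (W - 1) ^ 2 := by
  obtain ⟨ζ, h⟩ : ∃ ζ : ℂ, IsPrimitiveRoot ζ 5 := ⟨_, Complex.isPrimitiveRoot_exp 5 (by norm_num)⟩
  have hζ : ζ ≠ 0 := h.ne_zero (by norm_num)
  have h5 := h.pow_eq_one
  have d : ∀ j : ℕ, th (ζ ^ j * x) = th (x ^ 25) + ζ ^ j * (-2 * x * FF (x ^ 5)) +
      (ζ ^ j) ^ 4 * (2 * x ^ 4 * GG (x ^ 5)) := by
    intro j
    rw [th_dissect (mul_ne_zero (pow_ne_zero j hζ) hx0) (norm_rot h hx j)]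
    have e5 : (ζ ^ j * x) ^ 5 = x ^ 5 := by
      rw [mul_pow, ← pow_mul, mul_comm j, pow_mul, h5, one_pow, one_mul]
    have e25 : (ζ ^ j * x) ^ 25 = x ^ 25 := by
      have : (ζ ^ j * x) ^ 25 = ((ζ ^ j * x) ^ 5) ^ 5 := by ring
      rw [this, e5]; ring
    rw [e5, e25]
    ring
  have d0 := d 0
  have d1 := d 1
  rw [pow_zero, one_mul, one_mul, one_pow, one_mul] at d0
  rw [pow_one] at d1
  have R := th_roots h hx0 hx
  rw [d1, d 2, d 3, d 4, d0, fac_add h] at R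
  have hx5 := norm_sq_lt hx (n := 5) (by norm_num)
  have S := th_sq (pow_ne_zero 5 hx0) hx5
  have e : (x ^ 5) ^ 5 = x ^ 25 := by ring
  rw [e] at S
  have hA : th (x ^ 25) ≠ 0 := th_ne (pow_ne_zero _ hx0) (norm_sq_lt hx (by norm_num))
  rw [d0] at ht
  generalize th (x ^ 25) = A at *
  generalize th (x ^ 5) = B at *
  obtain ⟨u, hu⟩ : ∃ u, u = -2 * x * FF (x ^ 5) / A := ⟨_, rfl⟩
  obtain ⟨v, hv⟩ : ∃ v, v = 2 * x ^ 4 * GG (x ^ 5) / A := ⟨_, rfl⟩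
  have hu' : -2 * x * FF (x ^ 5) = A * u := by rw [hu]; field_simp
  have hv' : 2 * x ^ 4 * GG (x ^ 5) = A * v := by rw [hv]; field_simp
  rw [hu', hv'] at R ht
  have ht1 : t = 1 + u + v := by rw [ht]; field_simp
  have hB : B ^ 2 = A ^ 2 * W := by rw [hW]; field_simp
  have huv : u * v = W - 1 := by
    have : A ^ 2 * (u * v) = A ^ 2 * (W - 1) := by
      linear_combination hB - S - (A * v) * hu' + (2 * x * FF (x ^ 5)) * hv'
    exact mul_left_cancel₀ (pow_ne_zero 2 hA) this
  have hR : 1 + u ^ 5 + v ^ 5 - 5 * u * v + 5 * u ^ 2 * v ^ 2 = W ^ 3 := by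
    have e6 : B ^ 6 = A ^ 6 * W ^ 3 := by
      calc B ^ 6 = (B ^ 2) ^ 3 := by ring
        _ = _ := by rw [hB]; ring
    apply mul_left_cancel₀ (pow_ne_zero 6 hA)
    rw [← e6, ← R]; ring
  rw [ht1, ← huv, ← hR]
  ring

lemma qPoch_eq (q : ℂ) : qPoch q q = E q := by
  unfold qPoch E
  congr 1; funext n
  rw [pow_succ']

lemma gq_eq {q : ℂ} (hq0 : q ≠ 0) (hq : ‖q‖ < 1) : gq q = th (q ^ 5) ^ 2 / th q ^ 2 := by
  have e : (q ^ 5) ^ 2 = q ^ 10 := by ring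
  rw [th_eq hq0 hq, th_eq (pow_ne_zero 5 hq0) (norm_sq_lt hq (by norm_num)), e]
  unfold gq
  simp only [qPoch_eq]
  have h1 := E_ne hq
  have h2 := E_ne (norm_sq_lt hq (n := 2) (by norm_num))
  have h3 := E_ne (norm_sq_lt hq (n := 10) (by norm_num))
  field_simp

end GF

/-- Modular equation of level five for `g`: for every `τ ∈ ℍ`,
`g(τ)⁵ − g(5τ) − 5g(τ)g(5τ)·P(g(τ),g(5τ)) = 25g(τ)²g(5τ)²·Q(g(τ),g(5τ))`. -/
theorem statement15 (τ : UpperHalfPlane) :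
    gfun τ ^ 5 - gfun (mul5 τ) -
        5 * gfun τ * gfun (mul5 τ) * Ppoly (gfun τ) (gfun (mul5 τ)) =
      25 * gfun τ ^ 2 * gfun (mul5 τ) ^ 2 * Qpoly (gfun τ) (gfun (mul5 τ)) := by
  have hq : ‖Qc τ‖ < 1 := by
    unfold Qc
    exact UpperHalfPlane.norm_exp_two_pi_I_lt_one τ
  have hq0 : Qc τ ≠ 0 := Complex.exp_ne_zero _
  have h5 : Qc (mul5 τ) = Qc τ ^ 5 := by
    unfold Qc
    rw [← Complex.exp_nat_mul]
    congr 1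
    have : ((mul5 τ : UpperHalfPlane) : ℂ) = 5 * (τ : ℂ) := rfl
    rw [this]
    push_cast
    ring
  unfold gfun Ppoly Qpoly
  rw [h5]
  have hq5 := GF.norm_sq_lt hq (n := 5) (by norm_num)
  have e : (Qc τ ^ 5) ^ 5 = Qc τ ^ 25 := by ring
  have n1 := GF.th_ne hq0 hq
  have n5 := GF.th_ne (pow_ne_zero 5 hq0) hq5
  have n25 := GF.th_ne (pow_ne_zero 25 hq0) (GF.norm_sq_lt hq (n := 25) (by norm_num))
  refine GF.final_alg (t := GF.th (Qc τ) / GF.th (Qc τ ^ 25))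
    (W := GF.th (Qc τ ^ 5) ^ 2 / GF.th (Qc τ ^ 25) ^ 2) (div_ne_zero n1 n25)
    (div_ne_zero (pow_ne_zero 2 n5) (pow_ne_zero 2 n25)) _ _ ?_ ?_
    (GF.theta_rel hq0 hq _ _ rfl rfl)
  · rw [GF.gq_eq hq0 hq]
    field_simp
  · rw [GF.gq_eq (pow_ne_zero 5 hq0) hq5, e]
    field_simp
end

section
/- Let τ ∈ ℍ be an imaginary quadratic point. Then T₁(τ) and T₂(τ) are algebraic units, i.e. each of T₁(τ), 1/T₁(τ), T₂(τ), 1/T₂(τ) is integral over ℤ. -/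
open Complex

/-- A point `τ ∈ ℍ` is an imaginary quadratic point if `aτ² + bτ + c = 0` for some
integers `a, b, c` with `a ≠ 0`. -/
def IsImagQuadratic (τ : UpperHalfPlane) : Prop :=
  ∃ a b c : ℤ, a ≠ 0 ∧ (a : ℂ) * (τ : ℂ) ^ 2 + (b : ℂ) * (τ : ℂ) + (c : ℂ) = 0

/-- `T₁(τ) = ((−q;q⁵)∞(−q⁴;q⁵)∞ − (q;q⁵)∞(q⁴;q⁵)∞)/((−q;q⁵)∞(−q⁴;q⁵)∞ + (q;q⁵)∞(q⁴;q⁵)∞)`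
with `q = e^{2πiτ}`. -/
noncomputable def T1fun (τ : UpperHalfPlane) : ℂ :=
  (qPoch (-Qc τ) (Qc τ ^ 5) * qPoch (-Qc τ ^ 4) (Qc τ ^ 5) -
      qPoch (Qc τ) (Qc τ ^ 5) * qPoch (Qc τ ^ 4) (Qc τ ^ 5)) /
    (qPoch (-Qc τ) (Qc τ ^ 5) * qPoch (-Qc τ ^ 4) (Qc τ ^ 5) +
      qPoch (Qc τ) (Qc τ ^ 5) * qPoch (Qc τ ^ 4) (Qc τ ^ 5))

/-- `T₂(τ) = ((−q²;q⁵)∞(−q³;q⁵)∞ − (q²;q⁵)∞(q³;q⁵)∞)/((−q²;q⁵)∞(−q³;q⁵)∞ + (q²;q⁵)∞(q³;q⁵)∞)`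
with `q = e^{2πiτ}`. -/
noncomputable def T2fun (τ : UpperHalfPlane) : ℂ :=
  (qPoch (-Qc τ ^ 2) (Qc τ ^ 5) * qPoch (-Qc τ ^ 3) (Qc τ ^ 5) -
      qPoch (Qc τ ^ 2) (Qc τ ^ 5) * qPoch (Qc τ ^ 3) (Qc τ ^ 5)) /
    (qPoch (-Qc τ ^ 2) (Qc τ ^ 5) * qPoch (-Qc τ ^ 3) (Qc τ ^ 5) +
      qPoch (Qc τ ^ 2) (Qc τ ^ 5) * qPoch (Qc τ ^ 3) (Qc τ ^ 5))


namespace S19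

open UpperHalfPlane Function PowerSeries
open scoped MatrixGroups ModularForm Manifold Real

/-- `f` has the expansion `∑ p_m q_N^m` on the upper half plane. -/
def HasExp (N : ℕ) (p : PowerSeries ℂ) (f : ℍ → ℂ) : Prop :=
  ∀ τ : ℍ, HasSum (fun m : ℕ => p.coeff m * (Periodic.qParam (N : ℝ) τ) ^ m) (f τ)

/-- all coefficients are algebraic integers -/
def IntC (p : PowerSeries ℂ) : Prop := ∀ n, IsIntegral ℤ (p.coeff n)

/-- algebraic unit -/
def IsAU (x : ℂ) : Prop := IsIntegral ℤ x ∧ IsIntegral ℤ x⁻¹ ∧ x ≠ 0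

/-- Integral series with leading exponent `s` and leading coefficient a unit. -/
def UL (p : PowerSeries ℂ) (s : ℕ) : Prop :=
  IntC p ∧ (∀ n < s, p.coeff n = 0) ∧ IsAU (p.coeff s)

lemma IsAU.mul {x y : ℂ} (hx : IsAU x) (hy : IsAU y) : IsAU (x * y) :=
  ⟨hx.1.mul hy.1, by rw [mul_inv]; exact hx.2.1.mul hy.2.1, mul_ne_zero hx.2.2 hy.2.2⟩

lemma IsAU.inv {x : ℂ} (hx : IsAU x) : IsAU x⁻¹ :=
  ⟨hx.2.1, by rw [inv_inv]; exact hx.1, inv_ne_zero hx.2.2⟩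

lemma IsAU.one : IsAU 1 := ⟨isIntegral_one, by simpa using isIntegral_one, one_ne_zero⟩

lemma IsAU.neg {x : ℂ} (hx : IsAU x) : IsAU (-x) :=
  ⟨hx.1.neg, by rw [inv_neg]; exact hx.2.1.neg, neg_ne_zero.2 hx.2.2⟩

lemma isAU_of_pow_eq_one {x : ℂ} {n : ℕ} (hn : 0 < n) (h : x ^ n = 1) : IsAU x := by
  have h0 : x ≠ 0 := by rintro rfl; simp [hn.ne'] at h
  have h1 : IsIntegral ℤ x := IsIntegral.of_pow hn (h ▸ isIntegral_one)
  refine ⟨h1, IsIntegral.of_pow hn ?_, h0⟩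
  rw [inv_pow, h]; simpa using isIntegral_one

lemma isAU_of_pow {x : ℂ} {n : ℕ} (hn : 0 < n) (h : IsAU (x ^ n)) : IsAU x := by
  have h0 : x ≠ 0 := by rintro rfl; exact h.2.2 (by simp [hn.ne'])
  refine ⟨IsIntegral.of_pow hn h.1, IsIntegral.of_pow hn ?_, h0⟩
  rw [inv_pow]; exact h.2.1

lemma IntC.mul {p q : PowerSeries ℂ} (hp : IntC p) (hq : IntC q) : IntC (p * q) := by
  intro n
  rw [PowerSeries.coeff_mul]
  exact IsIntegral.sum _ fun x _ => (hp _).mul (hq _)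

lemma IntC.add {p q : PowerSeries ℂ} (hp : IntC p) (hq : IntC q) : IntC (p + q) := by
  intro n; rw [map_add]; exact (hp n).add (hq n)

lemma IntC.neg {p : PowerSeries ℂ} (hp : IntC p) : IntC (-p) := by
  intro n; rw [map_neg]; exact (hp n).neg

lemma IntC.sub {p q : PowerSeries ℂ} (hp : IntC p) (hq : IntC q) : IntC (p - q) := by
  intro n; rw [map_sub]; exact (hp n).sub (hq n)

lemma IntC.zero : IntC 0 := by intro n; simpa using isIntegral_zero

lemma IntC.one : IntC 1 := by
  intro n; rw [PowerSeries.coeff_one]; split_ifs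
  · exact isIntegral_one
  · exact isIntegral_zero

lemma IntC.pow {p : PowerSeries ℂ} (hp : IntC p) (k : ℕ) : IntC (p ^ k) := by
  induction k with
  | zero => simpa using IntC.one
  | succ k ih => rw [pow_succ]; exact ih.mul hp

lemma IntC.prod {ι : Type*} (s : Finset ι) {p : ι → PowerSeries ℂ} (hp : ∀ i ∈ s, IntC (p i)) :
    IntC (∏ i ∈ s, p i) := by
  classical
  induction s using Finset.induction_on with
  | empty => simpa using IntC.one
  | insert a s ha ih =>
    rw [Finset.prod_insert ha]
    exact (hp a (by simp)).mul (ih fun i hi => hp i (by simp [hi]))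

lemma IntC.sum {ι : Type*} (s : Finset ι) {p : ι → PowerSeries ℂ} (hp : ∀ i ∈ s, IntC (p i)) :
    IntC (∑ i ∈ s, p i) := by
  classical
  induction s using Finset.induction_on with
  | empty => simpa using IntC.zero
  | insert a s ha ih =>
    rw [Finset.sum_insert ha]
    exact (hp a (by simp)).add (ih fun i hi => hp i (by simp [hi]))

lemma coeff_mul_lead {p q : PowerSeries ℂ} {s t : ℕ} (hp : ∀ n < s, p.coeff n = 0)
    (hq : ∀ n < t, q.coeff n = 0) :
    (∀ n < s + t, (p * q).coeff n = 0) ∧ (p * q).coeff (s + t) = p.coeff s * q.coeff t := by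
  constructor
  · intro n hn
    rw [PowerSeries.coeff_mul]
    refine Finset.sum_eq_zero fun x hx => ?_
    rw [Finset.HasAntidiagonal.mem_antidiagonal] at hx
    by_cases h : x.1 < s
    · rw [hp _ h, zero_mul]
    · rw [hq x.2 (by omega), mul_zero]
  · rw [PowerSeries.coeff_mul, Finset.sum_eq_single (s, t)]
    · intro x hx hne
      rw [Finset.HasAntidiagonal.mem_antidiagonal] at hx
      by_cases h : x.1 < s
      · rw [hp _ h, zero_mul]
      · by_cases h' : x.2 < t
        · rw [hq _ h', mul_zero]
        · exact absurd (Prod.ext (by simp; omega) (by simp; omega)) hne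
    · intro h; simp at h

lemma UL.mul {p q : PowerSeries ℂ} {s t : ℕ} (hp : UL p s) (hq : UL q t) :
    UL (p * q) (s + t) := by
  have h := coeff_mul_lead hp.2.1 hq.2.1
  exact ⟨hp.1.mul hq.1, h.1, by rw [h.2]; exact hp.2.2.mul hq.2.2⟩

lemma UL.one : UL 1 0 := ⟨IntC.one, by simp, by simpa using IsAU.one⟩

lemma UL.pow {p : PowerSeries ℂ} {s : ℕ} (hp : UL p s) (k : ℕ) : UL (p ^ k) (k * s) := by
  induction k with
  | zero => simpa using UL.one
  | succ k ih => rw [pow_succ, add_mul, one_mul]; exact ih.mul hp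

lemma UL.prod {ι : Type*} (S : Finset ι) {p : ι → PowerSeries ℂ} {s : ι → ℕ}
    (hp : ∀ i ∈ S, UL (p i) (s i)) : UL (∏ i ∈ S, p i) (∑ i ∈ S, s i) := by
  classical
  induction S using Finset.induction_on with
  | empty => simpa using UL.one
  | insert a S ha ih =>
    rw [Finset.prod_insert ha, Finset.sum_insert ha]
    exact (hp a (by simp)).mul (ih fun i hi => hp i (by simp [hi]))

lemma UL.sub_lt {p q : PowerSeries ℂ} {s t : ℕ} (hp : UL p s) (hq : UL q t) (h : s < t) :
    UL (p - q) s := by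
  refine ⟨hp.1.sub hq.1, fun n hn => ?_, ?_⟩
  · rw [map_sub, hp.2.1 n hn, hq.2.1 n (by omega), sub_zero]
  · rw [map_sub, hq.2.1 s h, sub_zero]; exact hp.2.2

lemma UL.neg {p : PowerSeries ℂ} {s : ℕ} (hp : UL p s) : UL (-p) s :=
  ⟨hp.1.neg, fun n hn => by rw [map_neg, hp.2.1 n hn, neg_zero], by
    rw [map_neg]; exact hp.2.2.neg⟩

lemma norm_q_lt {N : ℕ} (hN : 0 < N) (τ : ℍ) : ‖Periodic.qParam (N : ℝ) τ‖ < 1 :=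
  Periodic.norm_qParam_lt_one (by exact_mod_cast hN) τ.im_pos

lemma HasExp.add {N : ℕ} {p q : PowerSeries ℂ} {f g : ℍ → ℂ} (hf : HasExp N p f)
    (hg : HasExp N q g) : HasExp N (p + q) (fun τ => f τ + g τ) := by
  intro τ
  simpa [add_mul] using (hf τ).add (hg τ)

lemma HasExp.neg {N : ℕ} {p : PowerSeries ℂ} {f : ℍ → ℂ} (hf : HasExp N p f) :
    HasExp N (-p) (fun τ => - f τ) := by
  intro τ
  simpa using (hf τ).neg

lemma HasExp.sub {N : ℕ} {p q : PowerSeries ℂ} {f g : ℍ → ℂ} (hf : HasExp N p f)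
    (hg : HasExp N q g) : HasExp N (p - q) (fun τ => f τ - g τ) := by
  intro τ
  simpa [sub_mul] using (hf τ).sub (hg τ)

lemma HasExp.const (N : ℕ) (a : ℂ) : HasExp N (PowerSeries.C a) (fun _ => a) := by
  intro τ
  have := hasSum_ite_eq (0 : ℕ) a
  refine this.congr_fun ?_ |> fun h => h
  intro m
  rw [PowerSeries.coeff_C]
  split_ifs with h <;> simp [h]

lemma HasExp.mul {N : ℕ} {p q : PowerSeries ℂ} {f g : ℍ → ℂ} (hf : HasExp N p f)
    (hg : HasExp N q g) : HasExp N (p * q) (fun τ => f τ * g τ) := by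
  intro τ
  have h1 := (hf τ).summable.norm
  have h2 := (hg τ).summable.norm
  have h3 := summable_norm_sum_mul_antidiagonal_of_summable_norm h1 h2
  have h4 := tsum_mul_tsum_eq_tsum_sum_antidiagonal_of_summable_norm h1 h2
  rw [(hf τ).tsum_eq, (hg τ).tsum_eq] at h4
  change HasSum _ (f τ * g τ)
  rw [h4]
  refine (h3.of_norm.hasSum).congr_fun ?_ |> fun h => h
  intro m
  rw [PowerSeries.coeff_mul, Finset.sum_mul]
  refine Finset.sum_congr rfl fun x hx => ?_
  rw [Finset.HasAntidiagonal.mem_antidiagonal] at hx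
  rw [← hx, pow_add]; ring

lemma HasExp.pow {N : ℕ} {p : PowerSeries ℂ} {f : ℍ → ℂ} (hf : HasExp N p f) (k : ℕ) :
    HasExp N (p ^ k) (fun τ => f τ ^ k) := by
  induction k with
  | zero => simpa using HasExp.const N 1
  | succ k ih => simp only [pow_succ]; exact ih.mul hf

lemma HasExp.prod {ι : Type*} {N : ℕ} (s : Finset ι) {p : ι → PowerSeries ℂ} {f : ι → ℍ → ℂ}
    (hf : ∀ i ∈ s, HasExp N (p i) (f i)) :
    HasExp N (∏ i ∈ s, p i) (fun τ => ∏ i ∈ s, f i τ) := by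
  classical
  induction s using Finset.induction_on with
  | empty => simpa using HasExp.const N 1
  | insert a s ha ih =>
    simp only [Finset.prod_insert ha]
    exact (hf a (by simp)).mul (ih fun i hi => hf i (by simp [hi]))

lemma HasExp.sum {ι : Type*} {N : ℕ} (s : Finset ι) {p : ι → PowerSeries ℂ} {f : ι → ℍ → ℂ}
    (hf : ∀ i ∈ s, HasExp N (p i) (f i)) :
    HasExp N (∑ i ∈ s, p i) (fun τ => ∑ i ∈ s, f i τ) := by
  classical
  induction s using Finset.induction_on with
  | empty => simpa using HasExp.const N 0
  | insert a s ha ih =>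
    simp only [Finset.sum_insert ha]
    exact (hf a (by simp)).add (ih fun i hi => hf i (by simp [hi]))

/-- `p(ζ X^k)` -/
noncomputable def scl (ζ : ℂ) (k : ℕ) (p : PowerSeries ℂ) : PowerSeries ℂ :=
  PowerSeries.mk fun m => if k ∣ m then p.coeff (m / k) * ζ ^ (m / k) else 0

lemma scl_coeff_mul (ζ : ℂ) {k : ℕ} (hk : 0 < k) (p : PowerSeries ℂ) (m : ℕ) :
    (scl ζ k p).coeff (k * m) = p.coeff m * ζ ^ m := by
  simp [scl, Nat.mul_div_cancel_left m hk]

lemma scl_hasSum {ζ x y a : ℂ} {k : ℕ} (hk : 0 < k) {p : PowerSeries ℂ}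
    (h : HasSum (fun m : ℕ => p.coeff m * y ^ m) a) (hy : y = ζ * x ^ k) :
    HasSum (fun m : ℕ => (scl ζ k p).coeff m * x ^ m) a := by
  have hinj : Function.Injective (fun m : ℕ => k * m) := fun a b h => by
    simpa [hk.ne'] using h
  rw [← hinj.hasSum_iff]
  · refine h.congr_fun ?_ |> fun h => h
    intro m
    simp only [Function.comp, scl_coeff_mul ζ hk, hy, mul_pow, ← pow_mul]; ring
  · intro m hm
    have : ¬ k ∣ m := by rintro ⟨c, rfl⟩; exact hm ⟨c, rfl⟩
    simp [scl, this]

lemma UL.scl {p : PowerSeries ℂ} {s : ℕ} (hp : UL p s) {ζ : ℂ} (hζ : IsAU ζ) {k : ℕ}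
    (hk : 0 < k) : UL (scl ζ k p) (k * s) := by
  have hζp : ∀ n : ℕ, IsAU (ζ ^ n) := fun n => by
    induction n with
    | zero => simpa using IsAU.one
    | succ n ih => rw [pow_succ]; exact ih.mul hζ
  refine ⟨fun n => ?_, fun n hn => ?_, ?_⟩
  · by_cases h : k ∣ n
    · obtain ⟨c, rfl⟩ := h
      rw [scl_coeff_mul ζ hk]; exact (hp.1 _).mul (hζp _).1
    · simp [S19.scl, h, isIntegral_zero]
  · by_cases h : k ∣ n
    · obtain ⟨c, rfl⟩ := h
      rw [scl_coeff_mul ζ hk, hp.2.1 c (by nlinarith [Nat.lt_of_mul_lt_mul_left hn]), zero_mul]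
    · simp [S19.scl, h]
  · rw [scl_coeff_mul ζ hk]; exact hp.2.2.mul (hζp _)

end S19

namespace S19

open UpperHalfPlane Function PowerSeries ModularGroup Filter
open scoped MatrixGroups ModularForm Manifold Real Topology

lemma exists_q {N : ℕ} (hN : 0 < N) {q : ℂ} (hq : ‖q‖ < 1) (h0 : q ≠ 0) :
    ∃ τ : ℍ, Periodic.qParam (N : ℝ) τ = q := by
  have hN' : (0 : ℝ) < N := by exact_mod_cast hN
  have h1 := Periodic.im_invQParam_pos_of_norm_lt_one hN' hq h0
  exact ⟨⟨_, h1⟩, Periodic.qParam_right_inv hN'.ne' h0⟩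

lemma HasExp.mdiff {N : ℕ} (hN : 0 < N) {p : PowerSeries ℂ} {f : ℍ → ℂ} (hf : HasExp N p f) :
    MDiff f := by
  have hN' : (0 : ℝ) < N := by exact_mod_cast hN
  let c : FormalMultilinearSeries ℂ ℂ ℂ := .ofScalars ℂ (fun m => p.coeff m)
  have hrad : 1 ≤ c.radius := by
    refine ENNReal.le_of_forall_nnreal_lt fun r hr => ?_
    have hr1 : (r : ℝ) < 1 := by exact_mod_cast hr
    by_cases h0 : r = 0
    · simp [h0]
    obtain ⟨τ, hτ⟩ := exists_q hN (q := ((r : ℝ) : ℂ)) (by simpa using hr1) (by simpa using h0)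
    apply FormalMultilinearSeries.le_radius_of_summable_norm
    have := (hf τ).summable.norm
    rw [hτ] at this
    refine this.congr fun m => ?_
    simp [c]
  have hball := (c.hasFPowerSeriesOnBall (lt_of_lt_of_le one_pos hrad)).mono one_pos hrad
  have hd := hball.differentiableOn
  rw [UpperHalfPlane.mdifferentiable_iff]
  have key : ∀ z : ℂ, 0 < z.im → (f ∘ ofComplex) z = c.sum (Periodic.qParam (N : ℝ) z) := by
    intro z hz
    have h1 := hf ⟨z, hz⟩
    simp only [comp, ofComplex_apply_of_im_pos hz]
    rw [← h1.tsum_eq, FormalMultilinearSeries.sum]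
    refine tsum_congr fun m => ?_
    simp [c, mul_comm]
  have : DifferentiableOn ℂ (fun z => c.sum (Periodic.qParam (N : ℝ) z)) {z : ℂ | 0 < z.im} := by
    refine hd.comp (t := Metric.eball 0 1) ?_ ?_
    · exact (Periodic.differentiable_qParam).differentiableOn
    · intro z hz
      have := Periodic.norm_qParam_lt_one hN' hz
      simpa [enorm_eq_nnnorm, ← NNReal.coe_lt_coe] using this
  exact this.congr fun z hz => key z hz

lemma HasExp.bdd {N : ℕ} (hN : 0 < N) {p : PowerSeries ℂ} {f : ℍ → ℂ} (hf : HasExp N p f) :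
    IsBoundedAtImInfty f :=
  isBoundedAtImInfty_of_hasSum_qExpansion (h := (N : ℝ)) (c := fun m => p.coeff m)
    (by exact_mod_cast hN) (fun τ => by simpa using hf τ)

lemma HasExp.periodic {N : ℕ} (hN : 0 < N) {p : PowerSeries ℂ} {f : ℍ → ℂ} (hf : HasExp N p f) :
    Periodic (f ∘ ofComplex) ((N : ℝ) : ℂ) := by
  intro z
  by_cases hz : 0 < z.im
  · have h2 : 0 < (z + ((N : ℝ) : ℂ)).im := by simpa using hz
    simp only [comp, ofComplex_apply_of_im_pos hz, ofComplex_apply_of_im_pos h2]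
    have h1 := hf ⟨z, hz⟩
    have h3 := hf ⟨_, h2⟩
    have : Periodic.qParam (N : ℝ) (z + ((N : ℝ) : ℂ)) = Periodic.qParam (N : ℝ) z :=
      by
        rw [Periodic.qParam, Periodic.qParam, mul_add, add_div, mul_div_cancel_right₀, Complex.exp_add, Complex.exp_two_pi_mul_I, mul_one]
        exact_mod_cast hN.ne'
    simp only at h1 h3
    rw [this] at h3
    exact h3.unique h1
  · have h2 : ¬ 0 < (z + ((N : ℝ) : ℂ)).im := by simpa using hz
    simp only [comp, ofComplex_apply_of_im_nonpos (not_lt.1 hz),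
      ofComplex_apply_of_im_nonpos (not_lt.1 h2)]

lemma HasExp.unique {N : ℕ} (hN : 0 < N) {p q : PowerSeries ℂ} {f : ℍ → ℂ} (hf : HasExp N p f)
    (hg : HasExp N q f) : p = q := by
  have hN' : (0 : ℝ) < N := by exact_mod_cast hN
  have han := analyticAt_cuspFunction_zero hN' (hf.periodic hN) (hf.mdiff hN) (hf.bdd hN)
  have h1 := (hasFPowerSeriesOnBall_cuspFunction hN' han (c := fun m => p.coeff m)
    (fun τ => by simpa using hf τ)).hasFPowerSeriesAt
  have h2 := (hasFPowerSeriesOnBall_cuspFunction hN' han (c := fun m => q.coeff m)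
    (fun τ => by simpa using hg τ)).hasFPowerSeriesAt
  ext m
  simpa using congr_arg (FormalMultilinearSeries.coeff · m) (h1.eq_formalMultilinearSeries h2)

lemma q_pow {N : ℕ} (hN : 0 < N) (τ : ℂ) :
    Periodic.qParam ((1 : ℕ) : ℝ) τ = 1 * (Periodic.qParam (N : ℝ) τ) ^ N := by
  rw [Periodic.qParam, Periodic.qParam, ← Complex.exp_nat_mul, one_mul]
  congr 1
  have : (N : ℂ) ≠ 0 := by exact_mod_cast hN.ne'
  push_cast; field_simp

lemma HasExp.scl {N : ℕ} (hN : 0 < N) {p : PowerSeries ℂ} {f : ℍ → ℂ} (hf : HasExp 1 p f) :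
    HasExp N (scl 1 N p) f := fun τ => scl_hasSum hN (hf τ) (q_pow hN τ)

lemma HasExp.down {N : ℕ} (hN : 0 < N) {p q : PowerSeries ℂ} {f : ℍ → ℂ} (hf : HasExp 1 p f)
    (hg : HasExp N q f) (m : ℕ) : p.coeff m = q.coeff (N * m) := by
  have h := (hf.scl hN).unique hN hg
  rw [← h, scl_coeff_mul _ hN]; simp

lemma HasExp.down_zero {N : ℕ} (hN : 0 < N) {p q : PowerSeries ℂ} {f : ℍ → ℂ} (hf : HasExp 1 p f)
    (hg : HasExp N q f) (m : ℕ) (hm : ¬ N ∣ m) : q.coeff m = 0 := by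
  have h := (hf.scl hN).unique hN hg
  rw [← h]; simp [S19.scl, hm]

lemma IntC.down {N : ℕ} (hN : 0 < N) {p q : PowerSeries ℂ} {f : ℍ → ℂ} (hf : HasExp 1 p f)
    (hg : HasExp N q f) (hq : IntC q) : IntC p := fun m => by
  rw [hf.down hN hg]; exact hq _

lemma UL.down {N : ℕ} (hN : 0 < N) {p q : PowerSeries ℂ} {f : ℍ → ℂ} (hf : HasExp 1 p f)
    (hg : HasExp N q f) {s : ℕ} (hq : UL q s) : ∃ t, s = N * t ∧ UL p t := by
  have : N ∣ s := by
    by_contra h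
    exact hq.2.2.2.2 (hf.down_zero hN hg s h)
  obtain ⟨t, rfl⟩ := this
  refine ⟨t, rfl, IntC.down hN hf hg hq.1, fun n hn => ?_, ?_⟩
  · rw [hf.down hN hg]; exact hq.2.1 _ (by gcongr)
  · rw [hf.down hN hg]; exact hq.2.2

/-- `f` is (the function of) a level one modular form of weight `k`. -/
def MF (k : ℤ) (f : ℍ → ℂ) : Prop := ∃ F : ModularForm 𝒮ℒ k, ⇑F = f

lemma MF.exp {k : ℤ} {f : ℍ → ℂ} (hf : MF k f) : HasExp 1 (qExpansion 1 f) f := by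
  obtain ⟨F, rfl⟩ := hf
  intro τ
  have := ModularForm.hasSum_qExpansion F one_pos
    one_mem_strictPeriods_SL τ
  simpa using this

lemma mkMF {k : ℤ} {f : ℍ → ℂ} {N : ℕ} (hN : 0 < N) {p : PowerSeries ℂ} (hf : HasExp N p f)
    (h : ∀ γ : SL(2, ℤ), f ∣[k] γ = f) : MF k f := by
  refine ⟨{ toFun := f
            slash_action_eq' := ?_
            holo' := hf.mdiff hN
            bdd_at_cusps' := ?_ }, rfl⟩
  · rintro _ ⟨A, rfl⟩
    exact h A
  · intro c hc
    rw [Subgroup.IsArithmetic.isCusp_iff_isCusp_SL2Z] at hc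
    rw [OnePoint.isBoundedAt_iff_forall_SL2Z hc]
    intro γ _
    rw [h]
    exact hf.bdd hN

lemma mkMF' {k : ℤ} {f : ℍ → ℂ} {N : ℕ} (hN : 0 < N) {p : PowerSeries ℂ} (hf : HasExp N p f)
    (hS : f ∣[k] S = f) (hT : f ∣[k] T = f) : MF k f :=
  mkMF hN hf (SlashInvariantForm.slash_action_generators_SL2Z hS hT)

lemma MF.slash {k : ℤ} {f : ℍ → ℂ} (hf : MF k f) (γ : SL(2, ℤ)) : f ∣[k] γ = f := by
  obtain ⟨F, rfl⟩ := hf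
  exact SlashInvariantForm.slash_action_eqn _ _ (by exact ⟨γ, rfl⟩)

end S19

namespace S19

open UpperHalfPlane Function PowerSeries ModularGroup Filter ModularForm EisensteinSeries
open scoped MatrixGroups ModularForm Manifold Real Topology ArithmeticFunction.sigma

lemma MF.mul {k l : ℤ} {f g : ℍ → ℂ} (hf : MF k f) (hg : MF l g) :
    MF (k + l) (fun τ => f τ * g τ) := by
  obtain ⟨F, rfl⟩ := hf
  obtain ⟨G, rfl⟩ := hg
  exact ⟨F.mul G, rfl⟩

lemma MF.sub {k : ℤ} {f g : ℍ → ℂ} (hf : MF k f) (hg : MF k g) :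
    MF k (fun τ => f τ - g τ) := by
  obtain ⟨F, rfl⟩ := hf
  obtain ⟨G, rfl⟩ := hg
  exact ⟨F - G, rfl⟩

lemma MF.smul {k : ℤ} {f : ℍ → ℂ} (hf : MF k f) (c : ℂ) :
    MF k (fun τ => c * f τ) := by
  obtain ⟨F, rfl⟩ := hf
  exact ⟨c • F, rfl⟩

lemma MF.cast {k l : ℤ} {f : ℍ → ℂ} (hf : MF k f) (h : k = l) : MF l f := h ▸ hf

lemma MF.one : MF 0 (fun _ => 1) := ⟨1, rfl⟩

lemma MF.pow {k : ℤ} {f : ℍ → ℂ} (hf : MF k f) (n : ℕ) : MF (n * k) (fun τ => f τ ^ n) := by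
  induction n with
  | zero => simpa using MF.one
  | succ n ih =>
    simp only [pow_succ]
    exact (ih.mul hf).cast (by push_cast; ring)

lemma mf_E4 : MF 4 E₄ := ⟨E₄, rfl⟩
lemma mf_E6 : MF 6 E₆ := ⟨E₆, rfl⟩
lemma mf_D : MF 12 discriminant := ⟨CuspForm.toModularFormₗ CuspForm.discriminant, rfl⟩

lemma isInt_nat (n : ℕ) : IsIntegral ℤ (n : ℂ) := by
  simpa using isIntegral_algebraMap (R := ℤ) (A := ℂ) (x := (n : ℤ))

lemma isInt_int (n : ℤ) : IsIntegral ℤ (n : ℂ) := by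
  simpa using isIntegral_algebraMap (R := ℤ) (A := ℂ) (x := n)

/-- `∑_{n≥1} σ_k(n) X^n` -/
noncomputable def sigS (k : ℕ) : PowerSeries ℂ :=
  PowerSeries.mk fun n => ((σ k n : ℕ) : ℂ)

lemma sigS_int (k : ℕ) : IntC (sigS k) := fun n => by
  simp only [sigS, PowerSeries.coeff_mk]
  exact isInt_nat _

lemma bern4 : bernoulli 4 = -1 / 30 := by
  rw [bernoulli_eq_bernoulli'_of_ne_one (by norm_num), bernoulli'_four]

lemma bern6 : bernoulli 6 = 1 / 42 := by
  have h5 : bernoulli' 5 = 0 := by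
    rw [bernoulli'_def]; norm_num [Finset.sum_range_succ, Nat.choose]
  rw [bernoulli_eq_bernoulli'_of_ne_one (by norm_num), bernoulli'_def]
  norm_num [Finset.sum_range_succ, Nat.choose, h5]

lemma qE4 : qExpansion 1 E₄ = 1 + PowerSeries.C 240 * sigS 3 := by
  ext m
  rw [E_qExpansion_coeff _ ⟨2, rfl⟩]
  by_cases h : m = 0
  · subst h; simp [sigS, -PowerSeries.coeff_zero_eq_constantCoeff]
  · simp only [h, if_false, map_add, PowerSeries.coeff_one, PowerSeries.coeff_C_mul, sigS,
      PowerSeries.coeff_mk]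
    norm_num [bern4]

lemma qE6 : qExpansion 1 E₆ = 1 - PowerSeries.C 504 * sigS 5 := by
  ext m
  rw [E_qExpansion_coeff _ ⟨3, rfl⟩]
  by_cases h : m = 0
  · subst h; simp [sigS, -PowerSeries.coeff_zero_eq_constantCoeff]
  · simp only [h, if_false, map_sub, PowerSeries.coeff_one, PowerSeries.coeff_C_mul, sigS,
      PowerSeries.coeff_mk]
    norm_num [bern6]

lemma dvd_sigma (n : ℕ) : ∃ c : ℤ, 5 * (σ 3 n : ℤ) + 7 * (σ 5 n : ℤ) = 12 * c := by
  have h : (12 : ℤ) ∣ 5 * (σ 3 n : ℤ) + 7 * (σ 5 n : ℤ) := by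
    rw [ArithmeticFunction.sigma_apply, ArithmeticFunction.sigma_apply]
    push_cast
    rw [Finset.mul_sum, Finset.mul_sum, ← Finset.sum_add_distrib]
    refine Finset.dvd_sum fun d _ => ?_
    have h : ∀ x : ZMod 12, 5 * x ^ 3 + 7 * x ^ 5 = 0 := by decide
    have := h ((d : ℤ) : ZMod 12)
    refine (ZMod.intCast_zmod_eq_zero_iff_dvd _ 12).1 ?_
    push_cast at this ⊢
    exact this
  exact h

lemma qD : ∃ r : PowerSeries ℂ, IntC r ∧ qExpansion 1 discriminant = r := by
  choose c hc using dvd_sigma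
  set A := sigS 3
  set B := sigS 5
  let r : PowerSeries ℂ := PowerSeries.mk (fun n => ((c n : ℤ) : ℂ)) + PowerSeries.C 100 * A ^ 2 +
    PowerSeries.C 8000 * A ^ 3 - PowerSeries.C 147 * B ^ 2
  have hC : ∀ k : ℕ, IntC (PowerSeries.C (k : ℂ)) := fun k n => by
    rw [PowerSeries.coeff_C]; split_ifs
    · exact isInt_nat _
    · exact isIntegral_zero
  refine ⟨r, ?_, ?_⟩
  · refine ((IntC.add ?_ ((hC 100).mul ((sigS_int 3).pow 2))).add
      ((hC 8000).mul ((sigS_int 3).pow 3))).sub ((hC 147).mul ((sigS_int 5).pow 2))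
    intro n
    rw [PowerSeries.coeff_mk]
    exact isInt_int _
  · have h1 : HasExp 1 (PowerSeries.C (1728⁻¹ : ℂ) *
        ((qExpansion 1 E₄) ^ 3 - (qExpansion 1 E₆) ^ 2)) discriminant := by
      have := (HasExp.const 1 (1728⁻¹ : ℂ)).mul ((mf_E4.exp.pow 3).sub (mf_E6.exp.pow 2))
      convert this using 1
      ext τ
      rw [discriminant_eq_E₄_cube_sub_E₆_sq]; ring
    rw [mf_D.exp.unique one_pos h1, qE4, qE6]
    have h2 : PowerSeries.C (5:ℂ) * A + PowerSeries.C (7:ℂ) * B =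
        PowerSeries.C (12:ℂ) * PowerSeries.mk (fun n => ((c n : ℤ) : ℂ)) := by
      ext n
      simp only [A, B, sigS, map_add, PowerSeries.coeff_C_mul, PowerSeries.coeff_mk]
      exact_mod_cast hc n
    have e : ∀ k : ℕ, PowerSeries.C (k : ℂ) = (k : PowerSeries ℂ) := fun k => by simp
    have e2 : PowerSeries.C (1728⁻¹ : ℂ) * (1728 : PowerSeries ℂ) = 1 := by
      have := e 1728
      push_cast at this
      rw [← this, ← map_mul]; norm_num
    have e5 := e 5; have e7 := e 7; have e12 := e 12; have e240 := e 240; have e504 := e 504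
    have e100 := e 100; have e8000 := e 8000; have e147 := e 147
    push_cast at e5 e7 e12 e240 e504 e100 e8000 e147
    simp only [r, e5, e7, e12, e240, e504, e100, e8000, e147] at h2 ⊢
    linear_combination (144 * PowerSeries.C (1728⁻¹ : ℂ)) * h2 + (PowerSeries.mk (fun n => ((c n : ℤ) : ℂ)) + 100 * A ^ 2 + 8000 * A ^ 3 - 147 * B ^ 2) * e2

lemma ul_D : UL (qExpansion 1 discriminant) 1 := by
  obtain ⟨r, hr, h⟩ := qD
  refine ⟨h ▸ hr, fun n hn => ?_, ?_⟩
  · obtain rfl : n = 0 := by omega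
    exact PowerSeries.coeff_of_lt_order _ (by rw [discriminant_qExpansion_order]; simp)
  · rw [discriminant_qExpansion_coeff_one]; exact IsAU.one

lemma coeff_D_one : (qExpansion 1 discriminant).coeff 1 = 1 := discriminant_qExpansion_coeff_one

lemma ul_E4 : UL (qExpansion 1 E₄) 0 := by
  refine ⟨?_, by simp, ?_⟩
  · rw [qE4]
    refine IntC.one.add (IntC.mul (fun n => ?_) (sigS_int 3))
    rw [PowerSeries.coeff_C]; split_ifs
    · exact_mod_cast isInt_nat 240
    · exact isIntegral_zero
  · rw [E_qExpansion_coeff_zero _ ⟨2, rfl⟩]; exact IsAU.one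

/-- the j-function -/
noncomputable def jf (τ : ℍ) : ℂ := E₄ τ ^ 3 / discriminant τ

lemma div_D_int {r p : PowerSeries ℂ} (hp : IntC p) (h : p = qExpansion 1 discriminant * r) :
    IntC r := by
  intro n
  induction n using Nat.strong_induction_on with
  | _ n ih =>
    have h1 := congrArg (fun t => PowerSeries.coeff (n + 1) t) h
    simp only [PowerSeries.coeff_mul] at h1
    rw [← Finset.add_sum_erase _ _ (a := (1, n)) (by simp [add_comm]), coeff_D_one, one_mul] at h1
    rw [← sub_eq_iff_eq_add] at h1
    rw [← h1]
    refine (hp _).sub (IsIntegral.sum _ fun x hx => ?_)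
    rw [Finset.mem_erase, Finset.HasAntidiagonal.mem_antidiagonal] at hx
    by_cases h0 : x.1 = 0
    · rw [h0, ul_D.2.1 0 one_pos, zero_mul]; exact isIntegral_zero
    · refine (ul_D.1 _).mul (ih _ ?_)
      have : x.1 ≠ 1 := fun h1 => hx.1 (Prod.ext h1 (by simp; omega))
      omega

theorem core (M : ℕ) : ∀ (f : ℍ → ℂ) (p : PowerSeries ℂ), MF (12 * M) f → HasExp 1 p f → IntC p →
    ∃ P : Polynomial ℂ, (∀ n, IsIntegral ℤ (P.coeff n)) ∧
      (∀ τ, f τ = discriminant τ ^ M * P.eval (jf τ)) ∧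
      ∀ s ≤ M, (∀ n < s, p.coeff n = 0) → P.natDegree ≤ M - s ∧ P.coeff (M - s) = p.coeff s := by
  induction M with
  | zero =>
    intro f p hf hp hi
    obtain ⟨F, rfl⟩ := hf.cast (l := 0) (by simp)
    obtain ⟨c, hc⟩ := ModularFormClass.levelOne_weight_zero_const F
    have h1 : HasExp 1 (PowerSeries.C c) F := by rw [hc]; exact HasExp.const 1 c
    obtain rfl := hp.unique one_pos h1
    refine ⟨Polynomial.C c, fun n => ?_, fun τ => by simp [hc], fun s hs _ => ?_⟩
    · rw [Polynomial.coeff_C, ← PowerSeries.coeff_C]; exact hi n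
    · obtain rfl : s = 0 := by omega
      simp
  | succ M ih =>
    intro f p hf hp hi
    set c0 := p.coeff 0 with hc0
    let g : ℍ → ℂ := fun τ => f τ - c0 * E₄ τ ^ (3 * (M + 1))
    have hg : MF (12 * (M + 1 : ℕ)) g :=
      hf.sub (((mf_E4.pow (3 * (M + 1))).cast (by push_cast; ring)).smul c0)
    set p' := p - PowerSeries.C c0 * (qExpansion 1 E₄) ^ (3 * (M + 1)) with hp'
    have hgp : HasExp 1 p' g := hp.sub ((HasExp.const 1 c0).mul (mf_E4.exp.pow _))
    have hE0 : ((qExpansion 1 E₄) ^ (3 * (M + 1))).coeff 0 = 1 := by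
      have h0 := E_qExpansion_coeff_zero (k := 4) (by norm_num) ⟨2, rfl⟩
      rw [PowerSeries.coeff_zero_eq_constantCoeff] at h0 ⊢
      rw [map_pow, h0, one_pow]
    have hp'0 : p'.coeff 0 = 0 := by
      rw [hp', map_sub, PowerSeries.coeff_C_mul, hE0, mul_one, sub_self]
    have hi' : IntC p' := by
      refine hi.sub (IntC.mul (fun n => ?_) (ul_E4.1.pow _))
      rw [PowerSeries.coeff_C]; split_ifs
      · exact hi 0
      · exact isIntegral_zero
    obtain ⟨G, hG⟩ := hg
    have hGq : qExpansion 1 G = p' := by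
      rw [hG]; exact (MF.exp ⟨G, hG⟩).unique one_pos hgp
    have hcusp : (qExpansion 1 G).coeff 0 = 0 := by rw [hGq]; exact hp'0
    set H := CuspForm.discriminantEquiv (toCuspForm G hcusp) with hH
    have hHmf : MF (12 * M) H := MF.cast ⟨H, rfl⟩ (by push_cast; ring)
    have hmul : p' = qExpansion 1 discriminant * qExpansion 1 H := by
      rw [← hGq]; exact qExpansion_eq_qExpansion_discriminant_mul G hcusp
    set r := qExpansion 1 H with hr
    have hri : IntC r := div_D_int hi' hmul
    have hHv : ∀ τ, g τ = discriminant τ * H τ := fun τ => by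
      rw [hH, discriminant_mul_discriminantEquiv_apply, ← hG]; rfl
    obtain ⟨P', h1, h2, h3⟩ := ih H r hHmf hHmf.exp hri
    refine ⟨Polynomial.C c0 * Polynomial.X ^ (M + 1) + P', fun n => ?_, fun τ => ?_, ?_⟩
    · rw [Polynomial.coeff_add, Polynomial.coeff_C_mul, Polynomial.coeff_X_pow]
      refine IsIntegral.add ?_ (h1 n)
      split_ifs
      · rw [mul_one]; exact hi 0
      · simpa using isIntegral_zero
    · have h4 := hHv τ
      have hD := discriminant_ne_zero τ
      rw [h2 τ] at h4
      have h5 : f τ = g τ + c0 * E₄ τ ^ (3 * (M + 1)) := by simp [g]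
      rw [h5, h4]
      simp only [Polynomial.eval_add, Polynomial.eval_mul, Polynomial.eval_C, Polynomial.eval_pow,
        Polynomial.eval_X]
      have h6 : E₄ τ ^ (3 * (M + 1)) = discriminant τ ^ (M + 1) * jf τ ^ (M + 1) := by
        rw [← mul_pow, jf, mul_div_cancel₀ _ hD, pow_mul]
      rw [h6]; ring
    · intro s hs hz
      have h30 := h3 0 (Nat.zero_le _) (by simp)
      rcases s with _ | s
      · refine ⟨?_, ?_⟩
        · refine (Polynomial.natDegree_add_le _ _).trans (max_le ?_ (by omega))
          exact (Polynomial.natDegree_C_mul_X_pow_le _ _)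
        · rw [Polynomial.coeff_add, Polynomial.coeff_C_mul, Polynomial.coeff_X_pow]
          rw [Polynomial.coeff_eq_zero_of_natDegree_lt (p := P') (by omega)]
          rw [Nat.sub_zero, if_pos rfl, mul_one, add_zero]
      · have hc00 : c0 = 0 := hz 0 (by omega)
        have hpp : p' = p := by rw [hp', hc00]; simp
        rw [hpp] at hmul
        have hrz : ∀ n < s, r.coeff n = 0 := by
          intro n
          induction n using Nat.strong_induction_on with
          | _ n ihn =>
            intro hn
            have := (coeff_mul_lead (q := r) ul_D.2.1 (t := n) (fun m hm => ihn m hm (by omega))).2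
            rw [← hmul, coeff_D_one, one_mul, hz _ (by omega)] at this
            exact this.symm
        have hl := (coeff_mul_lead (q := r) ul_D.2.1 (t := s) hrz).2
        rw [← hmul, coeff_D_one, one_mul] at hl
        have h4 := h3 s (by omega) hrz
        rw [hc00]
        simp only [map_zero, zero_mul, zero_add]
        rw [show M + 1 - (s + 1) = M - s by omega]
        refine ⟨h4.1, ?_⟩
        rw [h4.2, ← hl, add_comm]

/-- consequence for functions with unit leading coefficients -/
theorem coreUL {M N : ℕ} (hN : 0 < N) {f : ℍ → ℂ} {q : PowerSeries ℂ} {s : ℕ} (hf : MF (12 * M) f)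
    (hq : HasExp N q f) (hs : UL q s) :
    ∃ P : Polynomial ℂ, (∀ n, IsIntegral ℤ (P.coeff n)) ∧ IsAU P.leadingCoeff ∧
      (∀ τ, f τ = discriminant τ ^ M * P.eval (jf τ)) ∧ N * (P.natDegree) + s = N * M := by
  obtain ⟨t, rfl, ht⟩ := UL.down hN hf.exp hq hs
  obtain ⟨P, h1, h2, h3⟩ := core M f _ hf hf.exp ht.1
  have htM : t ≤ M := by
    by_contra hlt
    push Not at hlt
    have := h3 M le_rfl (fun n hn => ht.2.1 n (by omega))
    rw [Nat.sub_self] at this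
    have hP : P = 0 := by
      rw [Polynomial.eq_C_of_natDegree_le_zero this.1, this.2, ht.2.1 M hlt, map_zero]
    have hf0 : f = fun _ => 0 := by ext τ; rw [h2, hP]; simp
    have h0 : HasExp 1 (PowerSeries.C 0) f := by rw [hf0]; exact HasExp.const 1 0
    have := hf.exp.unique one_pos h0
    exact ht.2.2.2.2 (by rw [this]; simp)
  obtain ⟨h4, h5⟩ := h3 t htM ht.2.1
  have h6 : P.natDegree = M - t := by
    refine le_antisymm h4 (Polynomial.le_natDegree_of_ne_zero ?_)
    rw [h5]; exact ht.2.2.2.2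
  refine ⟨P, h1, ?_, h2, ?_⟩
  · rw [Polynomial.leadingCoeff, h6, h5]; exact ht.2.2
  · rw [h6, ← mul_add]; congr 1; omega

end S19

namespace S19

open UpperHalfPlane Function PowerSeries ModularGroup Filter ModularForm EisensteinSeries
open FixedDetMatrices
open scoped MatrixGroups ModularForm Manifold Real Topology

lemma integral_of_monic_root {P : Polynomial ℂ} (hP : P.Monic) (h : ∀ n, IsIntegral ℤ (P.coeff n))
    {x : ℂ} (hx : P.eval x = 0) : IsIntegral ℤ x := by
  let T : Subring ℂ := (integralClosure ℤ ℂ).toSubring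
  have hT : (↑P.coeffs : Set ℂ) ⊆ T := by
    intro c hc
    obtain ⟨n, _, rfl⟩ := Polynomial.mem_coeffs_iff.1 hc
    exact h n
  have h1 : IsIntegral (integralClosure ℤ ℂ) x := by
    refine ⟨P.toSubring T hT, (Polynomial.monic_toSubring P T hT).2 hP, ?_⟩
    have h2 := Polynomial.map_toSubring P T hT
    have h3 : (algebraMap (integralClosure ℤ ℂ) ℂ) = T.subtype := rfl
    rw [h3, ← Polynomial.eval_map]
    erw [h2]
    exact hx
  exact isIntegral_trans x h1

lemma integral_of_root {P : Polynomial ℂ} (hP : IsAU P.leadingCoeff)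
    (h : ∀ n, IsIntegral ℤ (P.coeff n))
    {x : ℂ} (hx : P.eval x = 0) : IsIntegral ℤ x := by
  refine integral_of_monic_root (P := Polynomial.C (P.leadingCoeff⁻¹) * P) ?_ (fun n => ?_) ?_
  · rw [Polynomial.Monic, Polynomial.leadingCoeff_mul, Polynomial.leadingCoeff_C,
      inv_mul_cancel₀ hP.2.2]
  · rw [Polynomial.coeff_C_mul]; exact hP.2.1.mul (h n)
  · simp [hx]

/-- integer matrices of determinant `n` -/
abbrev Dn (n : ℤ) := FixedDetMatrix (Fin 2) ℤ n

variable {n : ℤ}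

lemma det_cast (A : Dn n) : (A.1.map (Int.cast : ℤ → ℝ)).det = n := by
  have := (Int.castRingHom ℝ).map_det A.1
  rw [A.2] at this
  simpa using this.symm

/-- real version -/
noncomputable def toGL (hn : 0 < n) (A : Dn n) : GL (Fin 2) ℝ :=
  Matrix.GeneralLinearGroup.mkOfDetNeZero (A.1.map (Int.cast : ℤ → ℝ))
    (by rw [det_cast]; exact_mod_cast hn.ne')

lemma toGL_coe (hn : 0 < n) (A : Dn n) : (toGL hn A : Matrix (Fin 2) (Fin 2) ℝ) =
    A.1.map (Int.cast : ℤ → ℝ) := rfl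

lemma toGL_det (hn : 0 < n) (A : Dn n) : (toGL hn A).det.val = n := by
  rw [Matrix.GeneralLinearGroup.val_det_apply, toGL_coe, det_cast]

lemma toGL_smul (hn : 0 < n) (A : Dn n) (γ : SL(2, ℤ)) :
    toGL hn (γ • A) = (γ : GL (Fin 2) ℝ) * toGL hn A := by
  apply Units.ext
  change (γ.1 * A.1).map (Int.castRingHom ℝ) = γ.1.map (Int.castRingHom ℝ) * A.1.map (Int.castRingHom ℝ)
  exact Matrix.map_mul

/-- right multiplication -/
def rmul (γ : SL(2, ℤ)) (A : Dn n) : Dn n := ⟨A.1 * γ.1, by rw [Matrix.det_mul, A.2, γ.2, mul_one]⟩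

lemma toGL_rmul (hn : 0 < n) (A : Dn n) (γ : SL(2, ℤ)) :
    toGL hn (rmul γ A) = toGL hn A * (γ : GL (Fin 2) ℝ) := by
  apply Units.ext
  change (A.1 * γ.1).map (Int.castRingHom ℝ) = A.1.map (Int.castRingHom ℝ) * γ.1.map (Int.castRingHom ℝ)
  exact Matrix.map_mul

lemma smul_rmul (γ γ' : SL(2, ℤ)) (A : Dn n) : rmul γ (γ' • A) = γ' • rmul γ A := by
  apply FixedDetMatrices.ext'
  change (γ'.1 * A.1) * γ.1 = γ'.1 * (A.1 * γ.1)
  rw [Matrix.mul_assoc]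

/-- right multiplication as an equivalence -/
def rEquiv (γ : SL(2, ℤ)) : Dn n ≃ Dn n where
  toFun := rmul γ
  invFun := rmul γ⁻¹
  left_inv A := by
    apply FixedDetMatrices.ext'
    change A.1 * γ.1 * (γ⁻¹).1 = A.1
    rw [Matrix.mul_assoc]
    have : γ.1 * (γ⁻¹).1 = 1 := congrArg Subtype.val (mul_inv_cancel γ)
    rw [this, mul_one]
  right_inv A := by
    apply FixedDetMatrices.ext'
    change A.1 * (γ⁻¹).1 * γ.1 = A.1
    rw [Matrix.mul_assoc]
    have : (γ⁻¹).1 * γ.1 = 1 := congrArg Subtype.val (inv_mul_cancel γ)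
    rw [this, mul_one]

/-- cosets -/
abbrev Qn (n : ℤ) := MulAction.orbitRel.Quotient SL(2, ℤ) (Dn n)

lemma exists_reduce (A : Dn n) : ∃ γ : SL(2, ℤ), γ • A = reduce A := by
  induction A using reduce_rec with
  | base A h =>
    by_cases h1 : 0 < A.1 0 0
    · exact ⟨_, (reduce_of_pos h h1).symm⟩
    · rw [reduce_of_not_pos h h1]
      exact ⟨T ^ (-(-A.1 0 1 / -A.1 1 1)) * (S * S), by simp only [mul_smul]⟩
  | step A h ih =>
    obtain ⟨γ, hγ⟩ := ih
    rw [← reduce_reduceStep h, ← hγ]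
    exact ⟨γ * (S * T ^ (-(A.1 0 0 / A.1 1 0))), by simp only [mul_smul]; rfl⟩

lemma exists_rep (hn : 0 < n) (x : Qn n) : ∃ A ∈ reps n, (Quotient.mk'' A : Qn n) = x := by
  induction x using Quotient.inductionOn' with
  | h A =>
    refine ⟨reduce A, reduce_mem_reps hn.ne' A, ?_⟩
    obtain ⟨γ, hγ⟩ := exists_reduce A
    rw [← hγ]
    exact Quotient.sound' ⟨γ, rfl⟩

lemma finite_Qn (hn : 0 < n) : Finite (Qn n) := by
  have : Function.Surjective (fun A : reps n => (Quotient.mk'' A.1 : Qn n)) := fun x => by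
    obtain ⟨A, hA, h⟩ := exists_rep hn x
    exact ⟨⟨A, hA⟩, h⟩
  exact Finite.of_surjective _ this

/-- right multiplication on cosets -/
def qEquiv (γ : SL(2, ℤ)) : Qn n ≃ Qn n :=
  Quotient.congr (rEquiv γ) (by
    intro A B
    change (MulAction.orbitRel _ _) A B ↔ (MulAction.orbitRel _ _) (rmul γ A) (rmul γ B)
    rw [MulAction.orbitRel_apply, MulAction.orbitRel_apply]
    constructor
    · rintro ⟨g, rfl⟩
      exact ⟨g, (smul_rmul _ _ _).symm⟩
    · rintro ⟨g, hg⟩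
      refine ⟨g, (rEquiv γ).injective ?_⟩
      change rmul γ (g • B) = rmul γ A
      rw [smul_rmul]; exact hg)

/-- `E₄³` -/
noncomputable def E43 : ℍ → ℂ := fun τ => E₄ τ ^ 3

lemma mf_E43 : MF 12 E43 := (mf_E4.pow 3).cast (by norm_num)

/-- the factors -/
noncomputable def hA (hn : 0 < n) (A : Dn n) : ℍ → ℂ :=
  E43 * (discriminant ∣[(12 : ℤ)] toGL hn A) - (E43 ∣[(12 : ℤ)] toGL hn A) * discriminant

lemma hA_smul (hn : 0 < n) (A : Dn n) (γ : SL(2, ℤ)) : hA hn (γ • A) = hA hn A := by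
  have h : ∀ f, MF 12 f → f ∣[(12 : ℤ)] toGL hn (γ • A) = f ∣[(12 : ℤ)] toGL hn A := by
    intro f hf
    rw [toGL_smul, SlashAction.slash_mul, ← SL_slash, hf.slash]
  simp only [hA, h _ mf_D, h _ mf_E43]

lemma hA_rmul (hn : 0 < n) (A : Dn n) (γ : SL(2, ℤ)) :
    hA hn A ∣[(24 : ℤ)] γ = hA hn (rmul γ A) := by
  have h : ∀ f : ℍ → ℂ, f ∣[(12 : ℤ)] toGL hn (rmul γ A) = (f ∣[(12 : ℤ)] toGL hn A) ∣[(12 : ℤ)] γ := by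
    intro f
    rw [toGL_rmul, SlashAction.slash_mul, ← SL_slash]
  rw [hA, sub_eq_add_neg, SlashAction.add_slash, SlashAction.neg_slash, ← sub_eq_add_neg,
    show (24 : ℤ) = 12 + 12 by norm_num, mul_slash_SL2, mul_slash_SL2, mf_D.slash, mf_E43.slash,
    hA, h, h]

/-- the factors indexed by cosets -/
noncomputable def hQ (hn : 0 < n) (x : Qn n) : ℍ → ℂ :=
  Quotient.liftOn' x (hA hn) (by
    rintro A B ⟨g, rfl⟩
    exact hA_smul hn B g)

lemma hQ_slash (hn : 0 < n) (x : Qn n) (γ : SL(2, ℤ)) :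
    hQ hn x ∣[(24 : ℤ)] γ = hQ hn (qEquiv γ x) := by
  induction x using Quotient.inductionOn' with
  | h A => exact hA_rmul hn A γ

lemma prodQ_slash (hn : 0 < n) [Fintype (Qn n)] (γ : SL(2, ℤ)) :
    (∏ x : Qn n, hQ hn x) ∣[(24 : ℤ) * (Finset.univ : Finset (Qn n)).card] γ = ∏ x : Qn n, hQ hn x := by
  rw [SL_slash, prod_slash]
  have : |((γ : GL (Fin 2) ℝ)).det.val| = 1 := by simp
  rw [this, one_zpow, one_smul]
  simp_rw [← SL_slash, hQ_slash]
  exact Equiv.prod_comp (qEquiv γ) (hQ hn)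

lemma rep_exp (hn : 0 < n) (hsq : ¬ IsSquare n) {A : Dn n} (hAr : A ∈ reps n) :
    ∃ (c : ℂ) (k : ℍ → ℂ) (p : PowerSeries ℂ) (s : ℕ), c ≠ 0 ∧ (∀ τ, hA hn A τ = c * k τ) ∧
      HasExp n.toNat p k ∧ UL p s := by
  obtain ⟨h10, h00, -, hlt⟩ := hAr
  have hdet : A.1 0 0 * A.1 1 1 = n := by
    have := A.2
    rw [Matrix.det_fin_two, h10] at this
    simpa using this
  have h11 : 0 < A.1 1 1 := by
    rcases lt_trichotomy (A.1 1 1) 0 with h | h | h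
    · nlinarith
    · rw [h] at hdet; omega
    · exact h
  obtain ⟨a, ha⟩ : ∃ a : ℕ, A.1 0 0 = a := ⟨_, (Int.toNat_of_nonneg h00.le).symm⟩
  obtain ⟨d, hd⟩ : ∃ d : ℕ, A.1 1 1 = d := ⟨_, (Int.toNat_of_nonneg h11.le).symm⟩
  set b := A.1 0 1 with hb
  have hapos : 0 < a := by omega
  have hdpos : 0 < d := by omega
  have hN : n.toNat = a * d := by
    rw [← hdet, ha, hd]; norm_cast
  have hN0 : 0 < n.toNat := by rw [hN]; positivity
  set g := toGL hn A with hg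
  have hgdet : 0 < g.det.val := by rw [toGL_det]; exact_mod_cast hn
  have hden : ∀ τ : ℍ, denom g τ = d := by
    intro τ
    have e1 : g 1 0 = 0 := by change ((A.1 1 0 : ℤ) : ℝ) = 0; simp [h10]
    have e2 : g 1 1 = d := by change ((A.1 1 1 : ℤ) : ℝ) = d; simp [hd]
    simp [denom, e1, e2]
  have hact : ∀ τ : ℍ, ((g • τ : ℍ) : ℂ) = (a * τ + b) / d := by
    intro τ
    rw [coe_smul_of_det_pos hgdet, hden]
    have e1 : g 0 0 = a := by change ((A.1 0 0 : ℤ) : ℝ) = a; simp [ha]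
    have e2 : g 0 1 = b := rfl
    simp [num, e1, e2]
  have hsl : ∀ (f : ℍ → ℂ) (τ : ℍ), (f ∣[(12 : ℤ)] g) τ =
      ((n : ℂ) ^ (11 : ℤ) * (d : ℂ) ^ (-12 : ℤ)) * f (g • τ) := by
    intro f τ
    rw [slash_apply, hden, toGL_det, σ, if_pos hgdet]
    have : |(n : ℝ)| = n := abs_of_pos (by exact_mod_cast hn)
    rw [this]
    norm_num
    ring
  set ζ : ℂ := Complex.exp (2 * π * Complex.I * b / d) with hζ
  have hζd : ζ ^ d = 1 := by
    rw [hζ, ← Complex.exp_nat_mul]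
    have : (d : ℂ) ≠ 0 := by exact_mod_cast hdpos.ne'
    rw [show (d : ℂ) * (2 * π * Complex.I * b / d) = b * (2 * π * Complex.I) by field_simp]
    exact Complex.exp_int_mul_two_pi_mul_I b
  have hζu : IsAU ζ := isAU_of_pow_eq_one hdpos hζd
  have hq : ∀ τ : ℍ, Periodic.qParam ((1 : ℕ) : ℝ) ((g • τ : ℍ) : ℂ) =
      ζ * (Periodic.qParam (n.toNat : ℝ) τ) ^ (a ^ 2) := by
    intro τ
    rw [hact, hN, Periodic.qParam, Periodic.qParam, hζ, ← Complex.exp_nat_mul, ← Complex.exp_add]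
    congr 1
    have : (d : ℂ) ≠ 0 := by exact_mod_cast hdpos.ne'
    have : (a : ℂ) ≠ 0 := by exact_mod_cast hapos.ne'
    push_cast
    field_simp
    ring
  have ha2 : 0 < a ^ 2 := by positivity
  have hcomp : ∀ {f : ℍ → ℂ} {p : PowerSeries ℂ}, HasExp 1 p f →
      HasExp n.toNat (scl ζ (a ^ 2) p) (fun τ => f (g • τ)) := fun hf τ =>
    scl_hasSum ha2 (hf (g • τ)) (hq τ)
  have hE := mf_E4.exp.pow 3
  have hD := mf_D.exp
  refine ⟨(n : ℂ) ^ (11 : ℤ) * (d : ℂ) ^ (-12 : ℤ),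
    fun τ => E43 τ * discriminant (g • τ) - E43 (g • τ) * discriminant τ, _, min (a ^ 2) n.toNat,
    ?_, ?_, ((hE.scl hN0).mul (hcomp hD)).sub ((hcomp hE).mul (hD.scl hN0)), ?_⟩
  · have : (d : ℂ) ≠ 0 := by exact_mod_cast hdpos.ne'
    have : (n : ℂ) ≠ 0 := by exact_mod_cast hn.ne'
    positivity
  · intro τ
    simp only [hA, Pi.sub_apply, Pi.mul_apply]
    rw [hsl, hsl]; ring
  · have u1 := ((ul_E4.pow 3).scl IsAU.one hN0).mul (ul_D.scl hζu ha2)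
    have u2 := ((ul_E4.pow 3).scl hζu ha2).mul (ul_D.scl IsAU.one hN0)
    simp only [mul_zero, zero_add, mul_one] at u1 u2
    rcases lt_trichotomy (a ^ 2) n.toNat with h | h | h
    · rw [min_eq_left h.le]; exact u1.sub_lt u2 h
    · exfalso
      apply hsq
      refine ⟨a, ?_⟩
      have : ((a ^ 2 : ℕ) : ℤ) = n := by rw [h]; exact Int.toNat_of_nonneg hn.le
      rw [← this]; push_cast; ring
    · rw [min_eq_right h.le, ← neg_sub]; exact (u2.sub_lt u1 h).neg

theorem j_integral_of_fixed (hn : 0 < n) (hsq : ¬ IsSquare n) (A : Dn n) (τ : ℍ)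
    (hfix : toGL hn A • τ = τ) : IsIntegral ℤ (jf τ) := by
  classical
  have := finite_Qn hn
  have : Fintype (Qn n) := Fintype.ofFinite _
  have hN0 : 0 < n.toNat := by omega
  have key : ∀ x : Qn n, ∃ (c : ℂ) (k : ℍ → ℂ) (p : PowerSeries ℂ) (s : ℕ), c ≠ 0 ∧
      (∀ τ, hQ hn x τ = c * k τ) ∧ HasExp n.toNat p k ∧ UL p s := by
    intro x
    obtain ⟨B, hB, rfl⟩ := exists_rep hn x
    exact rep_exp hn hsq hB
  choose c k p s hc hck hexp hul using key
  set ψ := (Finset.univ : Finset (Qn n)).card with hψ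
  set cc := ∏ x, c x with hcc
  have hcc0 : cc ≠ 0 := Finset.prod_ne_zero_iff.2 fun x _ => hc x
  have hprod : ∀ z, (∏ x : Qn n, hQ hn x) z = cc * ∏ x, k x z := by
    intro z
    rw [Finset.prod_apply, hcc, ← Finset.prod_mul_distrib]
    exact Finset.prod_congr rfl fun x _ => hck x z
  have hK := HasExp.prod Finset.univ fun x _ => hexp x
  have hKu := UL.prod Finset.univ fun x _ => hul x
  have hG : HasExp n.toNat (PowerSeries.C cc * ∏ x, p x) (∏ x : Qn n, hQ hn x) := by
    have := (HasExp.const n.toNat cc).mul hK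
    convert this using 1
    ext z; exact hprod z
  have hGm := mkMF hN0 hG (prodQ_slash hn)
  have hKm : MF (12 * (2 * ψ : ℕ)) (fun z => ∏ x, k x z) := by
    have := (hGm.smul cc⁻¹).cast (l := 12 * (2 * ψ : ℕ)) (by push_cast; ring)
    convert this using 1
    ext z; rw [hprod, ← mul_assoc, inv_mul_cancel₀ hcc0, one_mul]
  obtain ⟨P, h1, h2, h3, -⟩ := coreUL hN0 hKm hK hKu
  refine integral_of_root h2 h1 ?_
  have h4 : hQ hn (Quotient.mk'' A) τ = 0 := by
    change hA hn A τ = 0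
    simp only [hA, Pi.sub_apply, Pi.mul_apply, slash_apply, hfix]
    have hgdet : 0 < (toGL hn A).det.val := by rw [toGL_det]; exact_mod_cast hn
    rw [σ, if_pos hgdet]
    simp
    try ring
  have h5 : k (Quotient.mk'' A) τ = 0 := by
    rw [hck] at h4
    exact (mul_eq_zero.1 h4).resolve_left (hc _)
  have h6 : ∏ x, k x τ = 0 := Finset.prod_eq_zero (Finset.mem_univ _) h5
  rw [h3 τ] at h6
  exact (mul_eq_zero.1 h6).resolve_left (pow_ne_zero _ (discriminant_ne_zero τ))

theorem j_integral (τ : ℍ) (hτ : IsImagQuadratic τ) : IsIntegral ℤ (jf τ) := by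
  obtain ⟨a, b, c, ha, h⟩ := hτ
  have hv := τ.im_pos
  have hre := congrArg Complex.re h
  have him := congrArg Complex.im h
  simp [pow_two] at hre him
  set u := τ.re
  set v := τ.im
  have hu : 2 * a * u + b = 0 := by
    have : v * (2 * a * u + b) = 0 := by linear_combination him
    exact (mul_eq_zero.1 this).resolve_left hv.ne'
  have hD : (0 : ℤ) < 4 * a * c - b ^ 2 := by
    have : (0 : ℝ) < ((4 * a * c - b ^ 2 : ℤ) : ℝ) := by
      have e : ((4 * a * c - b ^ 2 : ℤ) : ℝ) = 4 * a ^ 2 * v ^ 2 := by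
        push_cast
        linear_combination (4 * (a : ℝ)) * hre - (2 * a * u + b) * hu
      rw [e]
      have : (a : ℝ) ≠ 0 := by exact_mod_cast ha
      positivity
    exact_mod_cast this
  set D := 4 * a * c - b ^ 2 with hDdef
  set x := |b| + D with hx
  have hm : D ≤ 2 * x - b := by have := le_abs_self b; have := abs_nonneg b; omega
  set n := x ^ 2 - b * x + a * c with hn
  have h4n : 4 * n = (2 * x - b) ^ 2 + D := by rw [hn, hDdef]; ring
  have hnpos : 0 < n := by nlinarith [sq_nonneg (2 * x - b)]
  have hsq : ¬ IsSquare n := by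
    rintro ⟨y, hy⟩
    have h5 : (2 * |y|) ^ 2 = (2 * x - b) ^ 2 + D := by
      rw [← h4n, hy, mul_pow, sq_abs]; ring
    have hy0 := abs_nonneg y
    have h6 : 2 * x - b < 2 * |y| := by nlinarith
    have h7 : 2 * x - b + 1 ≤ 2 * |y| := h6
    nlinarith
  let A : Dn n := ⟨!![x - b, -c; a, x], by rw [Matrix.det_fin_two_of, hn]; ring⟩
  refine j_integral_of_fixed hnpos hsq A τ ?_
  have hgdet : 0 < (toGL hnpos A).det.val := by rw [toGL_det]; exact_mod_cast hnpos
  ext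
  rw [coe_smul_of_det_pos hgdet, div_eq_iff (denom_ne_zero _ τ)]
  have e1 : toGL hnpos A 0 0 = x - b := by change (((x - b : ℤ)) : ℝ) = _; push_cast; ring
  have e2 : toGL hnpos A 0 1 = -c := by change (((-c : ℤ)) : ℝ) = _; push_cast; ring
  have e3 : toGL hnpos A 1 0 = a := rfl
  have e4 : toGL hnpos A 1 1 = x := rfl
  simp only [num, denom, e1, e2, e3, e4]
  push_cast
  linear_combination -h

end S19
namespace S19
open UpperHalfPlane Function PowerSeries ModularGroup Filter ModularForm EisensteinSeries
open scoped MatrixGroups ModularForm Manifold Real Topology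

section units
variable {ι : Type}

/-- elementary symmetric function -/
noncomputable def esy (I : Finset ι) (i : ℕ) (g : ι → ℂ) : ℂ :=
  ∑ t ∈ Finset.powersetCard i I, ∏ u ∈ t, g u

lemma esy_mul (I : Finset ι) (i : ℕ) (g : ι → ℂ) (c : ℂ) :
    esy I i (fun u => c * g u) = c ^ i * esy I i g := by
  rw [esy, esy, Finset.mul_sum]
  refine Finset.sum_congr rfl fun t ht => ?_
  rw [Finset.prod_mul_distrib, Finset.prod_const, (Finset.mem_powersetCard.1 ht).2]

lemma esy_perm [DecidableEq ι] (I : Finset ι) (i : ℕ) (g : ι → ℂ) (σ : ι → ι) (h1 : Set.MapsTo σ I I)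
    (h2 : Set.InjOn σ I) : esy I i (fun u => g (σ u)) = esy I i g := by
  unfold esy
  rw [← Finset.esymm_map_val, ← Finset.esymm_map_val]
  have h : I.image σ = I := Finset.eq_of_subset_of_card_le
    (fun x hx => by
      obtain ⟨y, hy, rfl⟩ := Finset.mem_image.1 hx
      exact h1 hy) (by rw [Finset.card_image_of_injOn h2])
  have h3 := Finset.image_val_of_injOn h2
  rw [h] at h3
  conv_rhs => rw [h3, Multiset.map_map]
  rfl

lemma esy_congr (I : Finset ι) (i : ℕ) {g g' : ι → ℂ} (h : ∀ u ∈ I, g u = g' u) :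
    esy I i g = esy I i g' := by
  unfold esy
  refine Finset.sum_congr rfl fun t ht => Finset.prod_congr rfl fun u hu => h u ?_
  exact (Finset.mem_powersetCard.1 ht).1 hu

theorem units [DecidableEq ι] (I : Finset ι) (Ψ : ι → ℍ → ℂ) (p : ι → PowerSeries ℂ) (s : ι → ℕ) {N m : ℕ}
    (hN : 0 < N) (hexp : ∀ u ∈ I, HasExp N (p u) (Ψ u)) (hul : ∀ u ∈ I, UL (p u) (s u))
    (σS σT : ι → ι) (mS : Set.MapsTo σS I I) (iS : Set.InjOn σS I)
    (mT : Set.MapsTo σT I I) (iT : Set.InjOn σT I)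
    (hS : ∀ u ∈ I, ∀ τ, Ψ u (S • τ) = (τ : ℂ) ^ (12 * m) * Ψ (σS u) τ)
    (hT : ∀ u ∈ I, ∀ τ, Ψ u (T • τ) = Ψ (σT u) τ)
    (hsum : ∑ u ∈ I, s u = N * (m * I.card)) (τ : ℍ) (hj : IsIntegral ℤ (jf τ)) :
    ∀ u ∈ I, IsAU (Ψ u τ / discriminant τ ^ m) := by
  have hE : ∀ i, HasExp N (∑ t ∈ Finset.powersetCard i I, ∏ u ∈ t, p u)
      (fun τ => esy I i (fun u => Ψ u τ)) := fun i =>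
    HasExp.sum _ fun t ht => HasExp.prod t fun u hu => hexp u ((Finset.mem_powersetCard.1 ht).1 hu)
  have hI : ∀ i, IntC (∑ t ∈ Finset.powersetCard i I, ∏ u ∈ t, p u) := fun i =>
    IntC.sum _ fun t ht => IntC.prod t fun u hu => (hul u ((Finset.mem_powersetCard.1 ht).1 hu)).1
  have hM : ∀ i, MF (12 * (m * i : ℕ)) (fun τ => esy I i (fun u => Ψ u τ)) := by
    intro i
    refine mkMF' hN (hE i) ?_ ?_
    · ext z
      rw [SL_slash_apply, denom_S, esy_congr I i (fun u hu => hS u hu z),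
        esy_mul, esy_perm I i (fun u => Ψ u z) σS mS iS]
      have hz : (z : ℂ) ≠ 0 := ne_zero z
      rw [← pow_mul, zpow_neg]
      have : (z : ℂ) ^ (12 * ((m * i : ℕ) : ℤ)) = (z : ℂ) ^ (12 * m * i) := by
        rw [← zpow_natCast]; congr 1; push_cast; ring
      rw [this]
      field_simp
    · ext z
      rw [SL_slash_apply, esy_congr I i (fun u hu => hT u hu z),
        esy_perm I i (fun u => Ψ u z) σT mT iT]
      have : denom (T : GL (Fin 2) ℝ) z = 1 := by rw [ModularGroup.denom_apply]; simp [T]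
      rw [this]; simp
  have hD : discriminant τ ≠ 0 := discriminant_ne_zero τ
  have key : ∀ i, esy I i (fun u => Ψ u τ / discriminant τ ^ m) =
      esy I i (fun u => Ψ u τ) / discriminant τ ^ (m * i) := by
    intro i
    have := esy_mul I i (fun u => Ψ u τ) (discriminant τ ^ m)⁻¹
    rw [inv_pow, ← pow_mul] at this
    rw [div_eq_inv_mul, ← this]
    simp only [div_eq_inv_mul]
  have hintg : ∀ i, IsIntegral ℤ (esy I i (fun u => Ψ u τ / discriminant τ ^ m)) := by
    intro i
    obtain ⟨P, h1, h2, -⟩ := core (m * i) _ _ (hM i) (hM i).exp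
      (IntC.down hN (hM i).exp (hE i) (hI i))
    rw [key, h2, mul_div_cancel_left₀ _ (pow_ne_zero _ hD), Polynomial.eval_eq_sum]
    exact IsIntegral.sum _ fun n _ => (h1 n).mul (hj.pow n)
  have hu : ∀ u ∈ I, IsIntegral ℤ (Ψ u τ / discriminant τ ^ m) := by
    intro u hu
    set f : ι → ℂ := fun u => Ψ u τ / discriminant τ ^ m with hf
    set s := Multiset.map f I.val with hs
    refine integral_of_monic_root
      (P := (s.map (fun t => Polynomial.X - Polynomial.C t)).prod)
      (Polynomial.monic_multisetProd_X_sub_C s) (fun n => ?_) ?_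
    · by_cases hn : n ≤ s.card
      · rw [Multiset.prod_X_sub_C_coeff _ hn, hs, Finset.esymm_map_val]
        refine IsIntegral.mul ?_ (hintg _)
        exact (IsIntegral.neg isIntegral_one).pow _
      · rw [Polynomial.coeff_eq_zero_of_natDegree_lt]
        · exact isIntegral_zero
        · rw [Polynomial.natDegree_multiset_prod_X_sub_C_eq_card]; omega
    · rw [Polynomial.eval_multiset_prod]
      refine Multiset.prod_eq_zero ?_
      simp only [Multiset.map_map]
      refine Multiset.mem_map.2 ⟨f u, Multiset.mem_map_of_mem f hu, ?_⟩
      simp [hf]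
  have hprodU : IsAU (∏ u ∈ I, (Ψ u τ / discriminant τ ^ m)) := by
    have e1 : ∀ g : ι → ℂ, esy I I.card g = ∏ u ∈ I, g u := fun g => by
      simp [esy]
    have hm := hM I.card
    simp only [e1] at hm
    obtain ⟨P, h1, h2, h3, h4⟩ := coreUL hN hm (HasExp.prod I hexp) (UL.prod I hul)
    rw [hsum] at h4
    have h5 : P.natDegree = 0 := by
      have : N * P.natDegree = 0 := by omega
      exact (Nat.mul_eq_zero.1 this).resolve_left hN.ne'
    rw [← e1, key, e1, h3, mul_div_cancel_left₀ _ (pow_ne_zero _ hD),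
      Polynomial.eq_C_of_natDegree_eq_zero h5, Polynomial.eval_C]
    rwa [Polynomial.leadingCoeff, h5] at h2
  intro u hu'
  have e := Finset.mul_prod_erase I (fun u => Ψ u τ / discriminant τ ^ m) hu'
  have h0 : Ψ u τ / discriminant τ ^ m ≠ 0 := fun h0 => hprodU.2.2 (by
    exact Finset.prod_eq_zero hu' h0)
  refine ⟨hu u hu', ?_, h0⟩
  have : (Ψ u τ / discriminant τ ^ m)⁻¹ = (∏ u ∈ I, (Ψ u τ / discriminant τ ^ m))⁻¹ *
      ∏ u ∈ I.erase u, (Ψ u τ / discriminant τ ^ m) := by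
    rw [← e]
    have h1 : ∏ u ∈ I.erase u, (Ψ u τ / discriminant τ ^ m) ≠ 0 := fun h1 => hprodU.2.2 (by
      rw [← e, h1, mul_zero])
    generalize ∏ u ∈ I.erase u, (Ψ u τ / discriminant τ ^ m) = a at *
    generalize Ψ u τ / discriminant τ ^ m = b at *
    field_simp
  rw [this]
  exact hprodU.2.1.mul (IsIntegral.prod _ fun v hv => hu v (Finset.mem_of_mem_erase hv))

end units

/-- regrouping a series by finite fibres -/
lemma hasSum_fiber {c : ℤ → ℂ} {e : ℤ → ℕ} {x a : ℂ} [hfin : ∀ m, Fintype {n // e n = m}]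
    (h : HasSum (fun n => c n * x ^ e n) a) :
    HasSum (fun m => (∑ n : {n // e n = m}, c n) * x ^ m) a := by
  rw [← (Equiv.sigmaFiberEquiv e).hasSum_iff] at h
  refine h.sigma fun m => ?_
  have := hasSum_fintype (fun n : {n // e n = m} => c n * x ^ m)
  rw [Finset.sum_mul]
  convert this using 1
  ext n
  simp [Equiv.sigmaFiberEquiv, n.2]

end S19
namespace S19
open UpperHalfPlane Function PowerSeries ModularGroup Filter ModularForm EisensteinSeries
open scoped MatrixGroups ModularForm Manifold Real Topology

/-- `e(x) = exp(2πix)` -/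
noncomputable def ee (x : ℂ) : ℂ := Complex.exp (2 * π * Complex.I * x)

lemma ee_add (x y : ℂ) : ee (x + y) = ee x * ee y := by
  rw [ee, ee, ee, ← Complex.exp_add]; congr 1; ring

lemma ee_int (n : ℤ) : ee n = 1 := by
  rw [ee, Complex.exp_eq_one_iff]; exact ⟨n, by ring⟩

lemma ee_pow (x : ℂ) (n : ℕ) : ee x ^ n = ee (n * x) := by
  rw [ee, ee, ← Complex.exp_nat_mul]; congr 1; ring

lemma ee_ne (x : ℂ) : ee x ≠ 0 := Complex.exp_ne_zero _

lemma ee_root {x : ℂ} {n : ℕ} {m : ℤ} (h : n * x = m) : ee x ^ n = 1 := by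
  rw [ee_pow, h, ee_int]

lemma ee_eq {x y : ℂ} (n : ℤ) (h : x = y + n) : ee x = ee y := by
  rw [h, ee_add, ee_int, mul_one]

/-- terms of theta series -/
noncomputable def tterm (k l : ℤ) (τ : ℂ) (n : ℤ) : ℂ :=
  ee ((20 * n + k) ^ 2 * τ / 800 + (20 * n + k) * l / 400)

/-- theta series -/
noncomputable def th (k l : ℤ) (τ : ℂ) : ℂ := ∑' n : ℤ, tterm k l τ n

lemma tterm_eq (k l : ℤ) (τ : ℂ) (n : ℤ) : tterm k l τ n =
    ee (k ^ 2 * τ / 800 + k * l / 400) * jacobiTheta₂_term n ((k * τ + l) / 20) τ := by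
  rw [tterm, ee, ee, jacobiTheta₂_term, ← Complex.exp_add]
  congr 1; field_simp; ring

lemma hasSum_th (k l : ℤ) {τ : ℂ} (hτ : 0 < τ.im) : HasSum (tterm k l τ) (th k l τ) := by
  have : Summable (tterm k l τ) := by
    rw [funext (tterm_eq k l τ)]
    exact ((hasSum_jacobiTheta₂_term _ hτ).summable).mul_left _
  exact this.hasSum

lemma th_eq (k l : ℤ) (τ : ℂ) : th k l τ =
    ee (k ^ 2 * τ / 800 + k * l / 400) * jacobiTheta₂ ((k * τ + l) / 20) τ := by
  rw [th, funext (tterm_eq k l τ), tsum_mul_left]; rfl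

lemma th_T (k l : ℤ) (τ : ℂ) : th k l (τ + 1) = ee (-(k ^ 2 + 20 * k) / 800) * th k (l + k + 10) τ := by
  rw [th, th, ← tsum_mul_left]
  congr 1; ext n
  rw [tterm, tterm, ← ee_add]
  obtain ⟨j, hj⟩ : Even (n * (n - 1)) := by
    have := Int.even_mul_succ_self (n - 1)
    rwa [sub_add_cancel, mul_comm] at this
  have hj' : (n : ℂ) * (n - 1) = j + j := by exact_mod_cast hj
  apply ee_eq j
  push_cast
  linear_combination hj' / 2

lemma th_k (k l a : ℤ) (τ : ℂ) : th (k + 20 * a) l τ = th k l τ := by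
  rw [th, th, ← (Equiv.addRight a).tsum_eq (tterm k l τ)]
  congr 1; ext n
  simp only [tterm, Equiv.coe_addRight]
  congr 1; push_cast; ring

lemma th_l (k l b : ℤ) (τ : ℂ) : th k (l + 20 * b) τ = ee (k * b / 20) * th k l τ := by
  rw [th, th, ← tsum_mul_left]
  congr 1; ext n
  rw [tterm, tterm, ← ee_add]
  apply ee_eq (n * b)
  push_cast; ring

lemma th_S (k l : ℤ) {τ : ℂ} (hτ : 0 < τ.im) : th k l (-1 / τ) =
    (-Complex.I * τ) ^ (1 / 2 : ℂ) * ee (k * l / 400) * th l (-k) τ := by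
  have h0 : τ ≠ 0 := by rintro rfl; simp at hτ
  have h1 : (-Complex.I * τ) ^ (1 / 2 : ℂ) ≠ 0 := by
    rw [Complex.cpow_def_of_ne_zero (by simp [h0])]; exact Complex.exp_ne_zero _
  rw [th_eq, th_eq, jacobiTheta₂_functional_equation ((l * τ + (-k : ℤ)) / 20) τ]
  have e : ((l : ℂ) * τ + (-k : ℤ)) / 20 / τ = (k * (-1 / τ) + l) / 20 := by
    push_cast; field_simp; ring
  rw [e]
  have e2 : Complex.exp (-π * Complex.I * ((l * τ + (-k : ℤ)) / 20) ^ 2 / τ) =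
      ee (-((l * τ + (-k : ℤ)) / 20) ^ 2 / τ / 2) := by
    rw [ee]; congr 1; ring
  rw [e2]
  have e3 : ee ((k : ℂ) ^ 2 * (-1 / τ) / 800 + k * l / 400) = ee (k * l / 400) *
      ee ((l : ℂ) ^ 2 * τ / 800 + l * (-k : ℤ) / 400) *
        ee (-((l * τ + (-k : ℤ)) / 20) ^ 2 / τ / 2) := by
    rw [← ee_add, ← ee_add]; congr 1; push_cast; field_simp; ring
  rw [e3]
  field_simp

/-- the powers -/
noncomputable def Ps (k l : ℤ) (τ : ℍ) : ℂ := th k l τ ^ 2400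

lemma Ps_k (k l a : ℤ) (τ : ℍ) : Ps (k + 20 * a) l τ = Ps k l τ := by rw [Ps, th_k, Ps]

lemma Ps_l (k l b : ℤ) (τ : ℍ) : Ps k (l + 20 * b) τ = Ps k l τ := by
  rw [Ps, th_l, Ps, mul_pow, ee_root (m := 120 * k * b) (by push_cast; ring), one_mul]

lemma Ps_congr {k l k' l' : ℤ} (hk : (k : ZMod 20) = k') (hl : (l : ZMod 20) = l') (τ : ℍ) :
    Ps k l τ = Ps k' l' τ := by
  obtain ⟨a, ha⟩ := (ZMod.intCast_eq_intCast_iff_dvd_sub _ _ 20).1 hk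
  obtain ⟨b, hb⟩ := (ZMod.intCast_eq_intCast_iff_dvd_sub _ _ 20).1 hl
  obtain rfl : k' = k + 20 * a := by push_cast at ha; omega
  obtain rfl : l' = l + 20 * b := by push_cast at hb; omega
  rw [Ps_k, Ps_l]

lemma Ps_T (k l : ℤ) (τ : ℍ) : Ps k l (T • τ) = Ps k (l + k + 10) τ := by
  rw [Ps, modular_T_smul, coe_vadd, Ps]
  rw [show ((1 : ℝ) : ℂ) + (τ : ℂ) = τ + 1 by push_cast; ring, th_T, mul_pow,
    ee_root (m := -(k ^ 2 + 20 * k) * 3) (by push_cast; ring), one_mul]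

lemma Ps_S (k l : ℤ) (τ : ℍ) : Ps k l (S • τ) = (τ : ℂ) ^ 1200 * Ps l (-k) τ := by
  rw [Ps, modular_S_smul, Ps]
  change th k l ((-(τ : ℂ))⁻¹) ^ 2400 = _
  rw [show (-(τ : ℂ))⁻¹ = -1 / τ by rw [inv_neg, neg_div, one_div], th_S k l τ.im_pos, mul_pow,
    mul_pow, ee_root (m := 6 * k * l) (by push_cast; ring), mul_one]
  have e1 : ((-Complex.I * τ) ^ (1 / 2 : ℂ)) ^ 2 = -Complex.I * τ := by
    rw [← Complex.cpow_nat_mul]; norm_num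
  have e2 : ((-Complex.I * τ) ^ (1 / 2 : ℂ)) ^ 2400 = (τ : ℂ) ^ 1200 := by
    rw [show 2400 = 2 * (4 * 300) by norm_num, pow_mul, e1, pow_mul,
      show 1200 = 4 * 300 by norm_num, pow_mul (τ : ℂ)]
    congr 1
    rw [mul_pow, neg_pow, Complex.I_pow_four]; ring
  rw [e2]

/-- expansions -/
lemma fin_fiber (k : ℤ) (m : ℕ) : Finite {n : ℤ // ((20 * n + k) ^ 2).toNat = m} := by
  refine Set.Finite.to_subtype (s := {n : ℤ | ((20 * n + k) ^ 2).toNat = m}) ?_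
  refine (Set.finite_Icc (-(m + |k|) : ℤ) (m + |k|)).subset fun n hn => ?_
  simp only [Set.mem_ofPred_eq] at hn
  have h0 : (20 * n + k) ^ 2 = m := by
    rw [← hn, Int.toNat_of_nonneg (sq_nonneg _)]
  have h1 : |20 * n + k| ≤ m := by
    rw [← h0, ← sq_abs]; nlinarith [abs_nonneg (20 * n + k), Int.le_self_sq |20 * n + k|]
  rw [abs_le] at h1
  have := neg_abs_le k
  have := le_abs_self k
  constructor <;> omega

noncomputable instance (k : ℤ) (m : ℕ) : Fintype {n : ℤ // ((20 * n + k) ^ 2).toNat = m} :=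
  @Fintype.ofFinite _ (fin_fiber k m)

/-- coefficient -/
noncomputable def cc (k l n : ℤ) : ℂ := ee ((20 * n + k) * l / 400)

lemma cc_root (k l n : ℤ) : cc k l n ^ 400 = 1 :=
  ee_root (m := (20 * n + k) * l) (by push_cast; ring)

/-- the expansion -/
noncomputable def tp (k l : ℤ) : PowerSeries ℂ :=
  PowerSeries.mk fun m => ∑ n : {n : ℤ // ((20 * n + k) ^ 2).toNat = m}, cc k l n

lemma th_exp (k l : ℤ) : HasExp 800 (tp k l) (fun τ => th k l τ) := by
  intro τ
  have h := hasSum_th k l τ.im_pos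
  have h2 : HasSum (fun n : ℤ => cc k l n * (Periodic.qParam ((800 : ℕ) : ℝ) τ) ^
      ((20 * n + k) ^ 2).toNat) (th k l τ) := by
    convert h using 1
    ext n
    rw [tterm, ee_add, cc, mul_comm, Periodic.qParam, ← Complex.exp_nat_mul, ee]
    congr 2
    have : ((((20 * n + k) ^ 2).toNat : ℕ) : ℂ) = (20 * n + k) ^ 2 := by
      have h3 : ((((20 * n + k) ^ 2).toNat : ℕ) : ℤ) = (20 * n + k) ^ 2 :=
        Int.toNat_of_nonneg (sq_nonneg _)
      exact_mod_cast h3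
    rw [this]; push_cast; ring
  have h3 := hasSum_fiber h2
  simpa only [tp, PowerSeries.coeff_mk] using h3

lemma tp_int (k l : ℤ) : IntC (tp k l) := fun m => by
  rw [tp, PowerSeries.coeff_mk]
  exact IsIntegral.sum _ fun n _ => (isAU_of_pow_eq_one (by norm_num) (cc_root k l n)).1

lemma isAU_one_sub {w : ℂ} (hw : IsPrimitiveRoot w 20) : IsAU (1 - w) := by
  have h4 : w ^ 4 ≠ 1 := hw.pow_ne_one_of_pos_of_lt (by norm_num) (by norm_num)
  have h10 : w ^ 10 ≠ 1 := hw.pow_ne_one_of_pos_of_lt (by norm_num) (by norm_num)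
  have h20 : w ^ 20 = 1 := hw.pow_eq_one
  have h10' : w ^ 10 + 1 = 0 := by
    have : (w ^ 10 - 1) * (w ^ 10 + 1) = 0 := by linear_combination h20
    exact (mul_eq_zero.1 this).resolve_left (sub_ne_zero.2 h10)
  have h8 : w ^ 8 - w ^ 6 + w ^ 4 - w ^ 2 + 1 = 0 := by
    have : (w ^ 2 + 1) * (w ^ 8 - w ^ 6 + w ^ 4 - w ^ 2 + 1) = 0 := by linear_combination h10'
    refine (mul_eq_zero.1 this).resolve_left fun h => h4 ?_
    linear_combination (w ^ 2 - 1) * h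
  have hwi : IsIntegral ℤ w := (isAU_of_pow_eq_one (by norm_num) h20).1
  have e : (1 - w) * (w ^ 2 * (1 + w) * (1 + w ^ 4)) = 1 := by
    linear_combination -h8
  have hne : 1 - w ≠ 0 := left_ne_zero_of_mul_eq_one e
  refine ⟨isIntegral_one.sub hwi, ?_, hne⟩
  rw [inv_eq_of_mul_eq_one_right e]
  exact ((hwi.pow 2).mul (isIntegral_one.add hwi)).mul (isIntegral_one.add (hwi.pow 4))

lemma ee_prim {l : ℤ} (h : IsCoprime l 20) : IsPrimitiveRoot (ee (l / 20)) 20 := by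
  have h1 : IsPrimitiveRoot (ee (1 / 20)) 20 := by
    have := Complex.isPrimitiveRoot_exp 20 (by norm_num)
    convert this using 1
    rw [ee]; congr 1; push_cast; ring
  have h2 := h1.zpow_of_gcd_eq_one l (by
    rw [← Int.isCoprime_iff_gcd_eq_one]; exact_mod_cast h)
  have e : ee (l / 20) = ee (1 / 20) ^ l := by
    unfold ee
    rw [← Complex.exp_int_mul]; congr 1; ring
  rwa [e]

lemma tp_ul (k l : ℤ) (h1 : -10 < k) (h2 : k ≤ 10) (h3 : k = 10 → IsCoprime (l - 10) 20) :
    UL (tp k l) (k.natAbs ^ 2) := by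
  have hs : ∀ m : ℕ, ∀ n : ℤ, ((20 * n + k) ^ 2).toNat = m ↔ (20 * n + k) ^ 2 = (m : ℤ) := by
    intro m n
    have := sq_nonneg (20 * n + k)
    omega
  refine ⟨tp_int k l, fun m hm => ?_, ?_⟩
  · rw [tp, PowerSeries.coeff_mk]
    refine Finset.sum_eq_zero fun n _ => ?_
    exfalso
    have h := (hs m n).1 n.2
    have hm' : (m : ℤ) < k ^ 2 := by
      have : ((k.natAbs ^ 2 : ℕ) : ℤ) = k ^ 2 := by push_cast; exact sq_abs k
      rw [← this]; exact_mod_cast hm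
    rw [← h] at hm'
    rcases lt_trichotomy n.1 0 with hn | hn | hn
    · nlinarith
    · rw [hn] at hm'; simp at hm'
    · nlinarith
  · have hk2 : ((k.natAbs ^ 2 : ℕ) : ℤ) = k ^ 2 := by push_cast; exact sq_abs k
    rw [tp, PowerSeries.coeff_mk]
    have hz : ((20 * 0 + k) ^ 2).toNat = k.natAbs ^ 2 := by
      rw [hs, hk2]; ring
    by_cases hk : k = 10
    · have hz' : ((20 * (-1) + k) ^ 2).toNat = k.natAbs ^ 2 := by
        rw [hs, hk2, hk]; norm_num
      have hsum : ∑ n : {n : ℤ // ((20 * n + k) ^ 2).toNat = k.natAbs ^ 2}, cc k l n =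
          cc k l 0 + cc k l (-1) := by
        refine Finset.sum_eq_add (s := Finset.univ) (f := fun n : {n : ℤ // ((20 * n + k) ^ 2).toNat = k.natAbs ^ 2} => cc k l n) (⟨0, hz⟩ : {n : ℤ // ((20 * n + k) ^ 2).toNat = k.natAbs ^ 2})
          ⟨-1, hz'⟩ (by simp) ?_ (fun h => absurd (Finset.mem_univ _) h)
          (fun h => absurd (Finset.mem_univ _) h)
        rintro ⟨n, hn⟩ - ⟨hn1, hn2⟩
        exfalso
        rw [hs, hk2, hk] at hn
        have : n * (n + 1) = 0 := by nlinarith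
        rcases mul_eq_zero.1 this with h | h
        · exact hn1 (by simp [h])
        · exact hn2 (by ext; simp; omega)
      · have e : cc k l 0 + cc k l (-1) = ee (-l / 40) * (1 - ee ((l - 10 : ℤ) / 20)) := by
          rw [mul_sub, mul_one, ← ee_add, cc, cc, hk]
          have : ee (-(l : ℂ) / 40 + (l - 10 : ℤ) / 20) = - ee (l / 40) := by
            have h5 : ee (-1 / 2) = -1 := by
              rw [ee, show 2 * π * Complex.I * (-1 / 2) = -(π * Complex.I) by ring,
                Complex.exp_neg, Complex.exp_pi_mul_I]; norm_num
            rw [show -(l : ℂ) / 40 + (l - 10 : ℤ) / 20 = l / 40 + (-1 / 2) by push_cast; ring,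
              ee_add, h5]; ring
          rw [this, sub_neg_eq_add, add_comm]
          congr 2 <;> (push_cast; ring)
        rw [hsum, e]
        refine IsAU.mul ?_ (isAU_one_sub (ee_prim (h3 hk)))
        exact isAU_of_pow_eq_one (n := 40) (by norm_num) (ee_root (m := -l) (by push_cast; ring))
    · have hsum : ∑ n : {n : ℤ // ((20 * n + k) ^ 2).toNat = k.natAbs ^ 2}, cc k l n =
          cc k l 0 := by
        refine Finset.sum_eq_single (s := Finset.univ) (f := fun n : {n : ℤ // ((20 * n + k) ^ 2).toNat = k.natAbs ^ 2} => cc k l n) (⟨0, hz⟩ : {n : ℤ // ((20 * n + k) ^ 2).toNat = k.natAbs ^ 2})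
          ?_ (fun h => absurd (Finset.mem_univ _) h)
        rintro ⟨n, hn⟩ - hn1
        exfalso
        rw [hs, hk2] at hn
        have : n * (10 * n + k) = 0 := by nlinarith
        rcases mul_eq_zero.1 this with h | h
        · exact hn1 (by simp [h])
        · have : n ≤ 0 := by omega
          have : -1 < n := by omega
          have : n = 0 := by omega
          exact hn1 (by simp [this])
      rw [hsum]
      exact isAU_of_pow_eq_one (by norm_num) (cc_root k l 0)

/-- index set -/
def II : Finset (ZMod 20 × ZMod 20) :=
  Finset.univ.filter fun u => Nat.gcd (Nat.gcd (u.1 - 10).val (u.2 - 10).val) 20 = 1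

lemma card_II : II.card = 288 := by decide +kernel

lemma sum_II : ∑ u ∈ II, 2400 * (u.1.valMinAbs.natAbs ^ 2) = 800 * (100 * II.card) := by
  rw [card_II]; decide +kernel

lemma S_II : ∀ u ∈ II, ((u.2, -u.1) : ZMod 20 × ZMod 20) ∈ II := by
  simp only [II, Finset.mem_filter, Finset.mem_univ, true_and]
  decide +kernel
lemma T_II : ∀ u ∈ II, ((u.1, u.2 + u.1 + 10) : ZMod 20 × ZMod 20) ∈ II := by
  simp only [II, Finset.mem_filter, Finset.mem_univ, true_and]
  decide +kernel
lemma cop_II : ∀ u ∈ II, u.1 = 10 → IsCoprime (u.2.valMinAbs - 10) 20 := by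
  simp only [II, Finset.mem_filter, Finset.mem_univ, true_and, Int.isCoprime_iff_gcd_eq_one]
  decide +kernel

theorem Ps_units (τ : ℍ) (hτ : IsIntegral ℤ (jf τ)) (u : ZMod 20 × ZMod 20) (hu : u ∈ II) :
    IsAU (Ps u.1.valMinAbs u.2.valMinAbs τ / discriminant τ ^ 100) := by
  refine units II (fun u => Ps u.1.valMinAbs u.2.valMinAbs)
    (fun u => tp u.1.valMinAbs u.2.valMinAbs ^ 2400) (fun u => 2400 * (u.1.valMinAbs.natAbs ^ 2))
    (N := 800) (m := 100) (by norm_num) (fun u _ => (th_exp _ _).pow 2400)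
    (fun u hu => (tp_ul _ _ ?_ ?_ ?_).pow 2400)
    (fun u => (u.2, -u.1)) (fun u => (u.1, u.2 + u.1 + 10)) S_II ?_ T_II ?_ ?_ ?_ sum_II τ hτ u hu
  · have := (ZMod.valMinAbs_mem_Ioc u.1).1; push_cast at this; omega
  · have := (ZMod.valMinAbs_mem_Ioc u.1).2; push_cast at this; omega
  · intro h
    refine cop_II u hu ?_
    rw [← ZMod.coe_valMinAbs u.1, h]; rfl
  · rintro ⟨a, b⟩ - ⟨c, d⟩ - h
    simp at h ⊢
    tauto
  · rintro ⟨a, b⟩ - ⟨c, d⟩ - h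
    simp at h ⊢
    obtain ⟨rfl, h⟩ := h
    simpa using h
  · intro u _ τ
    simp only
    rw [Ps_S, show 12 * 100 = 1200 from rfl, Ps_congr (k' := u.2.valMinAbs)
      (l' := (-u.1).valMinAbs) (by simp) (by simp) τ]
  · intro u _ τ
    simp only
    rw [Ps_T]
    exact Ps_congr (by simp) (by simp) τ

/-- quotients of the relevant thetas are units -/
theorem th_quot (τ : ℍ) (hτ : IsIntegral ℤ (jf τ)) (a b : ZMod 20)
    (ha : (a, 0) ∈ II) (hb : (b, 0) ∈ II) :
    IsAU (th a.valMinAbs 0 τ / th b.valMinAbs 0 τ) := by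
  have h1 := Ps_units τ hτ _ ha
  have h2 := Ps_units τ hτ _ hb
  have h3 := h1.mul h2.inv
  refine isAU_of_pow (n := 2400) (by norm_num) ?_
  convert h3 using 1
  have hD : discriminant τ ^ 100 ≠ 0 := pow_ne_zero _ (discriminant_ne_zero τ)
  simp only [Ps, ZMod.valMinAbs_zero]
  rw [div_pow, inv_div]
  generalize discriminant τ ^ 100 = d at *
  generalize th a.valMinAbs 0 ↑τ ^ 2400 = x
  generalize th b.valMinAbs 0 ↑τ ^ 2400 = y
  field_simp

end S19
namespace S19
open UpperHalfPlane Function PowerSeries ModularGroup Filter ModularForm EisensteinSeries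
open scoped MatrixGroups ModularForm Manifold Real Topology

lemma norm_ee_lt {s : ℂ} (hs : 0 < s.im) : ‖ee s‖ < 1 := by
  rw [ee, Complex.norm_exp, Real.exp_lt_one_iff]
  have : (2 * π * Complex.I * s).re = -(2 * π * s.im) := by simp
  rw [this]
  have := Real.pi_pos
  nlinarith [mul_pos Real.pi_pos hs]

lemma ee_half : ee (1 / 2) = -1 := by
  rw [ee, show 2 * π * Complex.I * (1 / 2) = π * Complex.I by ring, Complex.exp_pi_mul_I]

lemma hs_congr {f g : ℤ → ℂ} {a : ℂ} (h : HasSum g a) (e : ∀ n, f n = g n) : HasSum f a := by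
  rwa [funext e]

lemma ee_zero : ee 0 = 1 := by simp [ee]

/-- finite `(Q;Q)_k` -/
noncomputable def qp (s : ℂ) (k : ℕ) : ℂ := ∏ i ∈ Finset.range k, (1 - ee s * ee s ^ i)

/-- inverse, extended by zero -/
noncomputable def rr (s : ℂ) (k : ℤ) : ℂ := if 0 ≤ k then (qp s k.toNat)⁻¹ else 0

lemma one_sub_ne {s : ℂ} (hs : 0 < s.im) (i : ℕ) : 1 - ee s * ee s ^ i ≠ 0 := by
  intro h
  have h1 : ee s ^ (i + 1) = 1 := by rw [pow_succ']; linear_combination -h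
  have h2 : ‖ee s‖ ^ (i + 1) < 1 := pow_lt_one₀ (norm_nonneg _) (norm_ee_lt hs) (by omega)
  rw [← norm_pow, h1] at h2
  simp at h2

lemma qp_ne {s : ℂ} (hs : 0 < s.im) (k : ℕ) : qp s k ≠ 0 :=
  Finset.prod_ne_zero_iff.2 fun i _ => one_sub_ne hs i

lemma rr_rec {s : ℂ} (hs : 0 < s.im) (k : ℤ) : rr s (k - 1) = (1 - ee (k * s)) * rr s k := by
  rcases lt_trichotomy k 0 with h | rfl | h
  · rw [rr, rr, if_neg (by omega), if_neg (by omega), mul_zero]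
  · simp [rr, ee_zero]
  · obtain ⟨m, rfl⟩ : ∃ m : ℕ, k = m + 1 := ⟨(k - 1).toNat, by omega⟩
    rw [rr, rr, if_pos (by omega), if_pos (by omega)]
    have e1 : ((m : ℤ) + 1 - 1).toNat = m := by omega
    have e2 : ((m : ℤ) + 1).toNat = m + 1 := by omega
    rw [e1, e2]
    have e3 : qp s (m + 1) = qp s m * (1 - ee s * ee s ^ m) := Finset.prod_range_succ _ _
    have e4 : ee (((m + 1 : ℤ) : ℂ) * s) = ee s * ee s ^ m := by
      rw [ee_pow, ← ee_add]; congr 1; push_cast; ring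
    rw [e3, e4]
    have := one_sub_ne hs m
    have := qp_ne hs m
    field_simp

/-- finite product -/
noncomputable def PN (s α : ℂ) (N : ℕ) : ℂ :=
  ∏ i ∈ Finset.range N, ((1 + ee α * ee s ^ i) * (1 + ee (s - α) * ee s ^ i))

/-- coefficients -/
noncomputable def cN (s : ℂ) (N : ℕ) (n : ℤ) : ℂ := qp s (2 * N) * (rr s (N + n) * rr s (N - n))

lemma finite_triple {s : ℂ} (hs : 0 < s.im) (α : ℂ) (N : ℕ) :
    HasSum (fun n : ℤ => cN s N n * ee (n * α + n * (n - 1) / 2 * s)) (PN s α N) := by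
  induction N with
  | zero =>
    have : PN s α 0 = (fun n : ℤ => cN s 0 n * ee (n * α + n * (n - 1) / 2 * s)) 0 := by
      simp [PN, cN, qp, rr, ee_zero]
    rw [this]
    refine hasSum_single 0 fun n hn => ?_
    rcases lt_or_gt_of_ne hn with h | h
    · simp [cN, rr, not_le.2 h]
    · simp [cN, rr, not_le.2 h]
  | succ N ih =>
    have h1 := ih.mul_left (1 + ee ((2 * N + 1) * s))
    have h2 := ((Equiv.subRight (1 : ℤ)).hasSum_iff.2 ih).mul_left (ee (α + N * s))
    have h3 := ((Equiv.addRight (1 : ℤ)).hasSum_iff.2 ih).mul_left (ee ((N + 1) * s - α))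
    have h := (h1.add h2).add h3
    have e : PN s α (N + 1) = (1 + ee ((2 * N + 1) * s)) * PN s α N + ee (α + N * s) * PN s α N +
        ee ((N + 1) * s - α) * PN s α N := by
      rw [PN, Finset.prod_range_succ, ← PN]
      have e1 : ee ((2 * N + 1) * s) = ee α * ee s ^ N * (ee (s - α) * ee s ^ N) := by
        rw [ee_pow, ← ee_add, ← ee_add, ← ee_add]; congr 1; ring
      have e2 : ee (α + N * s) = ee α * ee s ^ N := by rw [ee_pow, ← ee_add]
      have e3 : ee ((N + 1) * s - α) = ee (s - α) * ee s ^ N := by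
        rw [ee_pow, ← ee_add]; congr 1; ring
      rw [e1, e2, e3]; ring
    rw [e]
    refine hs_congr h fun n => ?_
    simp only [Function.comp, Equiv.subRight_apply, Equiv.coe_addRight]
    set x := ee ((N + 1 + n) * s) with hx
    set y := ee ((N + 1 - n) * s) with hy
    set R := rr s (N + 1 + n)
    set R' := rr s (N + 1 - n)
    set g := ee (n * α + n * (n - 1) / 2 * s) with hg
    set w := ee (-s) with hw
    have a1 : ee ((2 * N + 1) * s) = x * y * w := by
      rw [hx, hy, hw, ← ee_add, ← ee_add]; congr 1; ring
    have a2 : ee (α + N * s) * ee (((n - 1 : ℤ) : ℂ) * α + ((n - 1 : ℤ) : ℂ) * (((n - 1 : ℤ) : ℂ) - 1) / 2 * s)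
        = y * g := by
      rw [hy, hg, ← ee_add, ← ee_add]; congr 1; push_cast; ring
    have a3 : ee ((N + 1) * s - α) * ee (((n + 1 : ℤ) : ℂ) * α + ((n + 1 : ℤ) : ℂ) * (((n + 1 : ℤ) : ℂ) - 1) / 2 * s)
        = x * g := by
      rw [hx, hg, ← ee_add, ← ee_add]; congr 1; push_cast; ring
    have b1 : rr s (N + n) = (1 - x) * R := by
      have := rr_rec hs (N + 1 + n)
      rw [show (N : ℤ) + 1 + n - 1 = N + n by ring] at this
      rw [this, hx]; push_cast; rfl
    have b2 : rr s (N - n) = (1 - y) * R' := by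
      have := rr_rec hs (N + 1 - n)
      rw [show (N : ℤ) + 1 - n - 1 = N - n by ring] at this
      rw [this, hy]; push_cast; rfl
    have b3 : rr s (N + (n - 1)) = (1 - x * w) * ((1 - x) * R) := by
      have := rr_rec hs (N + n)
      rw [show (N : ℤ) + n - 1 = N + (n - 1) by ring] at this
      rw [this, b1, hx, hw, ← ee_add]; congr 3; push_cast; ring
    have b4 : rr s (N - (n + 1)) = (1 - y * w) * ((1 - y) * R') := by
      have := rr_rec hs (N - n)
      rw [show (N : ℤ) - n - 1 = N - (n + 1) by ring] at this
      rw [this, b2, hy, hw, ← ee_add]; congr 3; push_cast; ring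
    have b5 : rr s (N - (n - 1)) = R' := by
      rw [show (N : ℤ) - (n - 1) = N + 1 - n by ring]
    have b6 : rr s (N + (n + 1)) = R := by
      rw [show (N : ℤ) + (n + 1) = N + 1 + n by ring]
    have q1 : qp s (2 * (N + 1)) = qp s (2 * N) * (1 - x * y * w) * (1 - x * y) := by
      rw [show 2 * (N + 1) = 2 * N + 1 + 1 by ring, qp, Finset.prod_range_succ,
        Finset.prod_range_succ, ← qp]
      congr 2
      · rw [← a1, ee_pow, ← ee_add]; congr 2; push_cast; ring
      · rw [hx, hy, ee_pow, ← ee_add, ← ee_add]; congr 1; push_cast; ring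
    have c1 : cN s (N + 1) n = qp s (2 * N) * (1 - x * y * w) * (1 - x * y) * (R * R') := by
      rw [cN, q1]; push_cast; rfl
    have c2 : cN s N n = qp s (2 * N) * ((1 - x) * R * ((1 - y) * R')) := by rw [cN, b1, b2]
    have c3 : cN s N (n - 1) = qp s (2 * N) * ((1 - x * w) * ((1 - x) * R) * R') := by
      rw [cN, b3, b5]
    have c4 : cN s N (n + 1) = qp s (2 * N) * (R * ((1 - y * w) * ((1 - y) * R'))) := by
      rw [cN, b4, b6]
    rw [c1, c2, c3, c4, a1]
    linear_combination (-(qp s (2 * N) * ((1 - x * w) * ((1 - x) * R) * R'))) * a2 -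
      (qp s (2 * N) * (R * ((1 - y * w) * ((1 - y) * R')))) * a3

lemma tendsto_poch {s : ℂ} (hs : 0 < s.im) (a : ℂ) :
    Tendsto (fun N => ∏ i ∈ Finset.range N, (1 - a * ee s ^ i)) atTop (𝓝 (qPoch a (ee s))) := by
  have h : Summable fun i : ℕ => ‖-(a * ee s ^ i)‖ := by
    simp only [norm_neg, norm_mul, norm_pow]
    exact (summable_geometric_of_lt_one (norm_nonneg _) (norm_ee_lt hs)).mul_left _
  have := (multipliable_one_add_of_summable h).tendsto_prod_tprod_nat
  simp only [← sub_eq_add_neg] at this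
  exact this

lemma poch_ne {s : ℂ} (hs : 0 < s.im) : qPoch (ee s) (ee s) ≠ 0 := by
  have h : Summable fun i : ℕ => ‖-(ee s * ee s ^ i)‖ := by
    simp only [norm_neg, norm_mul, norm_pow]
    exact (summable_geometric_of_lt_one (norm_nonneg _) (norm_ee_lt hs)).mul_left _
  have := tprod_one_add_ne_zero_of_summable (f := fun i : ℕ => -(ee s * ee s ^ i))
    (fun i => by rw [← sub_eq_add_neg]; exact one_sub_ne hs i) h
  simp only [← sub_eq_add_neg] at this
  exact this

lemma bdd_of_tendsto {u : ℕ → ℂ} {x : ℂ} (h : Tendsto u atTop (𝓝 x)) :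
    ∃ C : ℝ, 0 ≤ C ∧ ∀ n, ‖u n‖ ≤ C := by
  obtain ⟨C, hC⟩ := (Metric.isBounded_range_of_tendsto u h).exists_norm_le
  have h' : ∀ n, ‖u n‖ ≤ C := fun n => hC _ ⟨n, rfl⟩
  exact ⟨C, (norm_nonneg _).trans (h' 0), h'⟩

/-- Jacobi triple product -/
theorem triple {s : ℂ} (hs : 0 < s.im) (α : ℂ) :
    qPoch (-ee α) (ee s) * qPoch (-ee (s - α)) (ee s) =
      (qPoch (ee s) (ee s))⁻¹ * ∑' n : ℤ, ee (n * α + n * (n - 1) / 2 * s) := by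
  set L := qPoch (ee s) (ee s) with hL
  have hL0 : L ≠ 0 := poch_ne hs
  have hq : Tendsto (qp s) atTop (𝓝 L) := tendsto_poch hs (ee s)
  have hqi : Tendsto (fun k => (qp s k)⁻¹) atTop (𝓝 L⁻¹) := hq.inv₀ hL0
  obtain ⟨C1, hC1, h1⟩ := bdd_of_tendsto hq
  obtain ⟨C2, hC2, h2⟩ := bdd_of_tendsto hqi
  have hrb : ∀ k, ‖rr s k‖ ≤ C2 := fun k => by
    rw [rr]; split_ifs
    · exact h2 _
    · simpa using hC2
  have hr : Tendsto (rr s) atTop (𝓝 L⁻¹) := by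
    have : Tendsto (fun k : ℤ => (qp s k.toNat)⁻¹) atTop (𝓝 L⁻¹) :=
      hqi.comp (tendsto_atTop.2 fun b => by
        filter_upwards [eventually_ge_atTop (b : ℤ)] with k hk; omega)
    refine this.congr' ?_
    filter_upwards [eventually_ge_atTop 0] with k hk
    rw [rr, if_pos hk]
  have hsumm : Summable fun n : ℤ => ee (n * α + n * (n - 1) / 2 * s) := by
    have := (hasSum_jacobiTheta₂_term (α - s / 2) hs).summable
    convert this using 1
    ext n
    rw [ee, jacobiTheta₂_term]; congr 1; ring
  have hlim : Tendsto (fun N => ∑' n : ℤ, cN s N n * ee (n * α + n * (n - 1) / 2 * s)) atTop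
      (𝓝 (∑' n : ℤ, L⁻¹ * ee (n * α + n * (n - 1) / 2 * s))) := by
    refine tendsto_tsum_of_dominated_convergence
      (bound := fun n : ℤ => C1 * (C2 * C2) * ‖ee (n * α + n * (n - 1) / 2 * s)‖)
      (hsumm.norm.mul_left _) (fun n => ?_) (Eventually.of_forall fun N n => ?_)
    · refine Tendsto.mul_const _ ?_
      have t1 : Tendsto (fun N : ℕ => qp s (2 * N)) atTop (𝓝 L) :=
        hq.comp (tendsto_id.const_mul_atTop' (by norm_num))
      have t2 : Tendsto (fun N : ℕ => rr s (N + n)) atTop (𝓝 L⁻¹) :=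
        hr.comp (tendsto_atTop_add_const_right _ _ tendsto_natCast_atTop_atTop)
      have t3 : Tendsto (fun N : ℕ => rr s (N - n)) atTop (𝓝 L⁻¹) :=
        hr.comp (tendsto_atTop_add_const_right _ (-n) tendsto_natCast_atTop_atTop)
      have := t1.mul (t2.mul t3)
      rwa [mul_inv_cancel_left₀ hL0] at this
    · rw [norm_mul]
      refine mul_le_mul_of_nonneg_right ?_ (norm_nonneg _)
      rw [cN, norm_mul, norm_mul]
      have := hrb (N + n)
      have := hrb (N - n)
      have := h1 (2 * N)
      gcongr
  rw [tsum_mul_left] at hlim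
  refine tendsto_nhds_unique ?_ hlim
  have := (tendsto_poch hs (-ee α)).mul (tendsto_poch hs (-ee (s - α)))
  refine this.congr fun N => ?_
  rw [(finite_triple hs α N).tsum_eq, PN, Finset.prod_mul_distrib]
  congr 1 <;> refine Finset.prod_congr rfl fun i _ => by ring

lemma hasSum_int_even_odd {f : ℤ → ℂ} {a b : ℂ} (ha : HasSum (fun m => f (2 * m)) a)
    (hb : HasSum (fun m => f (2 * m + 1)) b) : HasSum f (a + b) := by
  have i1 : Injective fun m : ℤ => 2 * m := fun x y h => by simpa using h
  have i2 : Injective fun m : ℤ => 2 * m + 1 := fun x y h => by simpa using h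
  have h1 := i1.hasSum_range_iff.2 ha
  have h2 := i2.hasSum_range_iff.2 hb
  refine HasSum.add_isCompl ⟨?_, ?_⟩ h1 h2
  · rw [Set.disjoint_left]
    rintro _ ⟨x, rfl⟩ ⟨y, hy⟩
    simp only at hy
    omega
  · rw [codisjoint_iff_le_sup]
    intro x _
    rcases Int.even_or_odd' x with ⟨k, h | h⟩
    · exact Or.inl ⟨k, h.symm⟩
    · exact Or.inr ⟨k, h.symm⟩

/-- the quotient as a theta quotient -/
theorem quot_eq (τ : ℍ) (j : ℤ) :
    (qPoch (-ee (j * τ)) (ee (5 * τ)) * qPoch (-ee ((5 - j) * τ)) (ee (5 * τ)) -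
      qPoch (ee (j * τ)) (ee (5 * τ)) * qPoch (ee ((5 - j) * τ)) (ee (5 * τ))) /
    (qPoch (-ee (j * τ)) (ee (5 * τ)) * qPoch (-ee ((5 - j) * τ)) (ee (5 * τ)) +
      qPoch (ee (j * τ)) (ee (5 * τ)) * qPoch (ee ((5 - j) * τ)) (ee (5 * τ))) =
    th (2 * j + 5) 0 (20 * τ) / th (2 * j - 5) 0 (20 * τ) := by
  have hs : 0 < (5 * (τ : ℂ)).im := by simpa using τ.im_pos
  have hs' : 0 < (20 * (τ : ℂ)).im := by simpa using τ.im_pos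
  have t1 := triple hs (j * τ)
  have t2 := triple hs (j * τ + 1 / 2)
  have e1 : 5 * (τ : ℂ) - j * τ = (5 - j) * τ := by ring
  have e2 : -ee (5 * (τ : ℂ) - (j * τ + 1 / 2)) = ee ((5 - j) * τ) := by
    rw [ee_eq (-1) (show 5 * (τ : ℂ) - (j * τ + 1 / 2) = ((5 - j) * τ + 1 / 2) + (-1 : ℤ) by
      push_cast; ring), ee_add, ee_half]; ring
  have e3 : -ee (j * (τ : ℂ) + 1 / 2) = ee (j * τ) := by rw [ee_add, ee_half]; ring
  rw [e1] at t1
  rw [e2, e3] at t2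
  set w := ee (-((2 * j - 5 : ℂ) ^ 2 * τ / 40)) with hw
  have hE := (hasSum_th (2 * j - 5) 0 hs').mul_left w
  have hO := (hasSum_th (2 * j + 5) 0 hs').mul_left w
  set E := th (2 * j - 5) 0 (20 * τ)
  set O := th (2 * j + 5) 0 (20 * τ)
  have s1 : HasSum (fun n : ℤ => ee (n * (j * τ) + n * (n - 1) / 2 * (5 * τ))) (w * E + w * O) := by
    refine hasSum_int_even_odd ?_ ?_
    · refine hs_congr hE fun m => ?_
      rw [hw, tterm, ← ee_add]; congr 1; push_cast; ring
    · refine hs_congr hO fun m => ?_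
      rw [hw, tterm, ← ee_add]; congr 1; push_cast; ring
  have s2 : HasSum (fun n : ℤ => ee (n * (j * τ + 1 / 2) + n * (n - 1) / 2 * (5 * τ)))
      (w * E + -(w * O)) := by
    refine hasSum_int_even_odd ?_ ?_
    · refine hs_congr hE fun m => ?_
      rw [hw, tterm, ← ee_add]; apply ee_eq m; push_cast; ring
    · refine hs_congr hO.neg fun m => ?_
      rw [hw, tterm, ← ee_add, ← neg_one_mul, ← ee_half, ← ee_add]
      apply ee_eq m; push_cast; ring
  rw [t1, t2, s1.tsum_eq, s2.tsum_eq]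
  have hL := inv_ne_zero (poch_ne hs)
  set L := (qPoch (ee (5 * τ)) (ee (5 * τ)))⁻¹
  have hw0 : w ≠ 0 := ee_ne _
  rw [show L * (w * E + w * O) - L * (w * E + -(w * O)) = (2 * L * w) * O by ring,
    show L * (w * E + w * O) + L * (w * E + -(w * O)) = (2 * L * w) * E by ring,
    mul_div_mul_left _ _ (by simp [hL, hw0])]

theorem main_unit (τ : ℍ) (hτ : IsImagQuadratic τ) (a b : ZMod 20)
    (ha : (a, 0) ∈ II) (hb : (b, 0) ∈ II) :
    IsAU (th a.valMinAbs 0 (20 * τ) / th b.valMinAbs 0 (20 * τ)) := by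
  have hs' : 0 < (20 * (τ : ℂ)).im := by simpa using τ.im_pos
  refine th_quot ⟨20 * τ, hs'⟩ (j_integral _ ?_) a b ha hb
  obtain ⟨x, y, z, hx, h⟩ := hτ
  refine ⟨x, 20 * y, 400 * z, hx, ?_⟩
  change (x : ℂ) * (20 * (τ : ℂ)) ^ 2 + (20 * y : ℤ) * (20 * (τ : ℂ)) + (400 * z : ℤ) = 0
  push_cast
  linear_combination 400 * h

lemma Qc_pow (τ : ℍ) (k : ℕ) : Qc τ ^ k = ee (k * τ) := by
  rw [Qc, ← Complex.exp_nat_mul, ee]; congr 1; ring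

lemma T1_eq (τ : ℍ) : T1fun τ = th 7 0 (20 * τ) / th (-3) 0 (20 * τ) := by
  have h := quot_eq τ 1
  have h1 : Qc τ = ee (((1 : ℤ) : ℂ) * τ) := by
    have := Qc_pow τ 1
    rw [pow_one] at this; rw [this]; norm_num
  have h4 : Qc τ ^ 4 = ee ((5 - ((1 : ℤ) : ℂ)) * τ) := by
    rw [Qc_pow]; congr 1; push_cast; ring
  have h5 : Qc τ ^ 5 = ee (5 * τ) := by rw [Qc_pow]; norm_num
  rw [← h1, ← h4, ← h5] at h
  exact h

lemma T2_eq (τ : ℍ) : T2fun τ = th 9 0 (20 * τ) / th (-1) 0 (20 * τ) := by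
  have h := quot_eq τ 2
  have h1 : Qc τ ^ 2 = ee (((2 : ℤ) : ℂ) * τ) := by rw [Qc_pow]; norm_num
  have h4 : Qc τ ^ 3 = ee ((5 - ((2 : ℤ) : ℂ)) * τ) := by
    rw [Qc_pow]; congr 1; push_cast; ring
  have h5 : Qc τ ^ 5 = ee (5 * τ) := by rw [Qc_pow]; norm_num
  rw [← h1, ← h4, ← h5] at h
  exact h

theorem final (τ : ℍ) (hτ : IsImagQuadratic τ) : IsAU (T1fun τ) ∧ IsAU (T2fun τ) := by
  rw [T1_eq, T2_eq]
  constructor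
  · exact main_unit τ hτ 7 17 (by decide +kernel) (by decide +kernel)
  · exact main_unit τ hτ 9 19 (by decide +kernel) (by decide +kernel)

end S19
/-- If `τ ∈ ℍ` is an imaginary quadratic point, then `T₁(τ)` and `T₂(τ)` are algebraic
units: each of `T₁(τ)`, `T₁(τ)⁻¹`, `T₂(τ)`, `T₂(τ)⁻¹` is integral over `ℤ`. -/
theorem statement19 (τ : UpperHalfPlane) (hτ : IsImagQuadratic τ) :
    (IsIntegral ℤ (T1fun τ) ∧ IsIntegral ℤ (T1fun τ)⁻¹) ∧
    (IsIntegral ℤ (T2fun τ) ∧ IsIntegral ℤ (T2fun τ)⁻¹) := by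
  obtain ⟨h1, h2⟩ := S19.final τ hτ
  exact ⟨⟨h1.1, h1.2.1⟩, ⟨h2.1, h2.2.1⟩⟩
end
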